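/- arXiv:1107.5756 — 4 statements merged into one kernel-verified Lean document; each statement's English description precedes it below -/
import Mathlib

section
/- Let $U \in \mathbb{Z}^{m \times n}$ and $\mathbf{b} \in \mathbb{Z}^m$ be such that the system $U\mathbf{y} = \mathbf{b}$ has a solution $\mathbf{y} \in \mathbb{Z}^n$. If all entries of the augmented matrix $[U, \mathbf{b}]$ have absolute value at most $e^H$, then there exists a solution $\mathbf{y} \in \mathbb{Z}^n$ all of whose entries have absolute value at most $e^{mH} \cdot m^{m/2}$. -/
open Matrix

/-- An element of a finite group generated by the `a j` is a short sum of them. -/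
lemma short_rep {G κ : Type*} [AddCommGroup G] [Finite G] [Fintype κ] (a : κ → G)
    (y : κ → ℤ) :
    ∃ l : List κ, (∀ j ∈ l, a j ≠ 0) ∧ (l.map a).sum = ∑ j, y j • a j ∧
      l.length < Nat.card G := by
  classical
  set t := ∑ j, y j • a j with ht
  have hex : ∃ k : ℕ, ∃ l : List κ, l.length = k ∧ (l.map a).sum = t := by
    have hmem : t ∈ AddSubgroup.closure (Set.range a) :=
      AddSubgroup.sum_mem _ fun j _ =>
        AddSubgroup.zsmul_mem _ (AddSubgroup.subset_closure (Set.mem_range_self j)) _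
    have hmem2 : t ∈ AddSubmonoid.closure (Set.range a) := by
      rw [← AddSubgroup.closure_toAddSubmonoid_of_finite]; exact hmem
    obtain ⟨l, hl, hs⟩ := AddSubmonoid.exists_list_of_mem_closure hmem2
    have hl' : l ∈ Set.range (List.map a) := by
      rw [Set.range_list_map]; exact hl
    obtain ⟨l0, rfl⟩ := hl'
    exact ⟨_, l0, rfl, hs⟩
  obtain ⟨l, hlen, hsum⟩ := Nat.find_spec hex
  have hmin : ∀ l' : List κ, (l'.map a).sum = t → l.length ≤ l'.length := by
    intro l' h'
    rw [hlen]
    exact Nat.find_min' hex ⟨l', rfl, h'⟩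
  refine ⟨l, ?_, hsum, ?_⟩
  · intro j hj h0
    have h1 : ((l.erase j).map a).sum = t := by
      rw [← hsum, ((List.perm_cons_erase hj).map a).sum_eq]
      simp [h0]
    have := hmin _ h1
    have h2 := List.length_erase_of_mem hj
    have h3 := List.length_pos_of_mem hj
    omega
  · by_contra hcon
    push Not at hcon
    have := Fintype.ofFinite G
    have hc : Fintype.card G < Fintype.card (Fin (l.length + 1)) := by
      rw [Fintype.card_fin, ← Nat.card_eq_fintype_card]; omega
    obtain ⟨i, j, hij, he⟩ := Fintype.exists_ne_map_eq_of_card_lt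
      (fun i : Fin (l.length + 1) => ((l.take i).map a).sum) hc
    wlog hlt : i < j generalizing i j
    · exact this j i hij.symm he.symm (lt_of_le_of_ne (not_lt.mp hlt) hij.symm)
    have h1 : (((l.take i) ++ (l.drop j)).map a).sum = t := by
      rw [List.map_append, List.sum_append, he, ← List.sum_append, ← List.map_append,
        List.take_append_drop, hsum]
    have h2 := hmin _ h1
    have h3 := j.2
    have h4 : (i : ℕ) < j := hlt
    simp at h2
    omega

/-- The cokernel of a nonsingular integer matrix has `|det|` elements. -/
lemma card_coker {ι : Type*} [Fintype ι] [DecidableEq ι] (B : Matrix ι ι ℤ) (hB : B.det ≠ 0) :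
    Nat.card ((ι → ℤ) ⧸ LinearMap.range B.mulVecLin) = B.det.natAbs := by
  have hinj : Function.Injective B.mulVecLin := by
    exact Matrix.mulVec_injective_of_det_ne_zero hB
  let e := LinearEquiv.ofInjective B.mulVecLin hinj
  rw [← Submodule.natAbs_det_equiv _ e]
  congr 1
  rw [← LinearMap.det_toLin']
  congr 1

lemma core {ι κ : Type*} [Fintype ι] [DecidableEq ι] [Fintype κ] [DecidableEq κ]
    (A : Matrix ι κ ℤ) (b : ι → ℤ) (y₀ : κ → ℤ) (hy₀ : A *ᵥ y₀ = b)
    (hne : ∃ g : ι → κ, (A.submatrix id g).det ≠ 0) (Y : ℤ)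
    (hY : ∀ g : ι → κ, |(A.submatrix id g).det| ≤ Y)
    (hYb : ∀ (g : ι → κ) (i : ι), |((A.submatrix id g).updateCol i b).det| ≤ Y) :
    ∃ y : κ → ℤ, A *ᵥ y = b ∧ ∀ j, |y j| ≤ Y := by
  obtain ⟨g₀, hg₀⟩ := hne
  have : Nonempty (ι → κ) := ⟨g₀⟩
  obtain ⟨g, hg⟩ := Finite.exists_max (fun g : ι → κ => |(A.submatrix id g).det|)
  set B := A.submatrix id g with hBdef
  have hX : 0 < |B.det| := lt_of_lt_of_le (abs_pos.mpr hg₀) (hg g₀)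
  have hB : B.det ≠ 0 := abs_pos.mp hX
  have hXY : |B.det| ≤ Y := hY g
  set N := LinearMap.range B.mulVecLin with hN
  have hcard := card_coker B hB
  have hfin : Finite ((ι → ℤ) ⧸ N) := by
    apply Nat.finite_of_card_ne_zero
    rw [hcard]; simpa using hB
  obtain ⟨l, hl0, hls, hll⟩ := short_rep (fun j => N.mkQ (A.col j)) y₀
  have hlX : (l.length : ℤ) + 1 ≤ |B.det| := by
    rw [hcard] at hll
    rw [Int.abs_eq_natAbs]
    exact_mod_cast hll
  have hb0 : b = ∑ j, y₀ j • A.col j := by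
    rw [← hy₀]; ext i; simp [Matrix.mulVec, dotProduct, mul_comm]
  have hmem : b - (l.map A.col).sum ∈ N := by
    rw [← Submodule.Quotient.mk_eq_zero, ← Submodule.mkQ_apply, map_sub, sub_eq_zero, map_list_sum,
      List.map_map]
    rw [hb0, map_sum]
    simp only [map_smul]
    exact hls.symm
  obtain ⟨v, hv⟩ := hmem
  have hv' : B *ᵥ v = b - (l.map A.col).sum := hv
  have hginj : Function.Injective g := by
    intro i j hij
    by_contra hne
    exact hB (Matrix.det_zero_of_column_eq hne (fun k => by simp [hBdef, hij]))
  have hlg : ∀ i, g i ∉ l := by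
    intro i hi
    refine hl0 _ hi ?_
    rw [Submodule.mkQ_apply, Submodule.Quotient.mk_eq_zero]
    refine ⟨Pi.single i 1, ?_⟩
    ext k
    simp [hBdef]
  -- bound on `v`
  have hvb : ∀ i, |v i| ≤ Y := by
    intro i
    have hcr : B.det * v i = cramer B b i - (l.map fun j => cramer B (A.col j) i).sum := by
      have h1 : cramer B (B *ᵥ v) = B.det • v := by
        rw [cramer_eq_adjugate_mulVec, mulVec_mulVec, adjugate_mul, smul_mulVec, one_mulVec]
      have h2 := congrFun h1 i
      rw [hv', map_sub, map_list_sum, List.map_map] at h2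
      simp only [Pi.smul_apply, smul_eq_mul, Pi.sub_apply] at h2
      rw [← h2]
      congr 1
      have := map_list_sum (Pi.evalAddMonoidHom (fun _ : ι => ℤ) i) (l.map (cramer B ∘ A.col))
      simpa [Function.comp_def] using this
    have hcb : |cramer B b i| ≤ Y := by
      rw [cramer_apply]; exact hYb g i
    have hcj : ∀ j, |cramer B (A.col j) i| ≤ |B.det| := by
      intro j
      rw [cramer_apply]
      suffices hE : B.updateCol i (A.col j) = A.submatrix id (Function.update g i j) by
        rw [hE]; exact hg _
      ext k k'
      by_cases h : k' = i
      · subst h; simp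
      · simp [h, hBdef]
    have hsum : ∀ l' : List κ,
        |(l'.map fun j => cramer B (A.col j) i).sum| ≤ l'.length * |B.det| := by
      intro l'
      induction l' with
      | nil => simp
      | cons a l' ih =>
        simp only [List.map_cons, List.sum_cons, List.length_cons]
        refine (abs_add_le _ _).trans ?_
        push_cast
        linarith [hcj a]
    have h3 : |B.det| * |v i| ≤ Y + l.length * |B.det| := by
      rw [← abs_mul, hcr]
      exact (abs_sub _ _).trans (add_le_add hcb (hsum l))
    have h4 : |B.det| * |v i| ≤ |B.det| * Y := by
      nlinarith
    exact le_of_mul_le_mul_left h4 hX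
  refine ⟨fun j => l.count j + ∑ i, if g i = j then v i else 0, ?_, ?_⟩
  · have h1 : A *ᵥ (fun j => (l.count j : ℤ)) = (l.map A.col).sum := by
      rw [Finset.sum_list_map_count]
      ext k
      rw [Finset.sum_subset (Finset.subset_univ _)]
      · simp [Matrix.mulVec, dotProduct, mul_comm]
      · intro x _ hx
        have : l.count x = 0 := List.count_eq_zero.mpr (by simpa using hx)
        simp [this]
    have h2 : A *ᵥ (fun j => ∑ i, if g i = j then v i else 0) = B *ᵥ v := by
      ext k
      simp only [Matrix.mulVec, dotProduct, Finset.mul_sum]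
      rw [Finset.sum_comm]
      simp [hBdef]
    have h3 := Matrix.mulVec_add A (fun j => (l.count j : ℤ))
      (fun j => ∑ i, if g i = j then v i else 0)
    rw [h1, h2, hv'] at h3
    have h4 : (l.map A.col).sum + (b - (l.map A.col).sum) = b := by abel
    rw [h4] at h3
    exact h3
  · intro j
    by_cases hj : ∃ i, g i = j
    · obtain ⟨i, rfl⟩ := hj
      have h0 : l.count (g i) = 0 := List.count_eq_zero.mpr (hlg i)
      simpa [h0, hginj.eq_iff] using hvb i
    · push Not at hj
      have h0 : l.count j ≤ l.length := List.count_le_length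
      have h1 : (l.count j : ℤ) ≤ l.length := by exact_mod_cast h0
      simp only [hj, if_false, Finset.sum_const_zero, add_zero]
      rw [abs_of_nonneg (by positivity)]
      linarith

lemma hadamard_fin (r : ℕ) (M : Matrix (Fin r) (Fin r) ℝ) (E : ℝ) (hE : 0 ≤ E)
    (h : ∀ i j, |M i j| ≤ E) : |M.det| ≤ E ^ r * (r : ℝ) ^ ((r : ℝ) / 2) := by
  let e := EuclideanSpace.basisFun (Fin r) ℝ
  have : Fact (Module.finrank ℝ (EuclideanSpace ℝ (Fin r)) = r) := ⟨by simp⟩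
  let o : Orientation ℝ (EuclideanSpace ℝ (Fin r)) (Fin r) := e.toBasis.orientation
  let v : Fin r → EuclideanSpace ℝ (Fin r) := fun i => WithLp.toLp 2 (M i)
  have h1 := o.abs_volumeForm_apply_le v
  rw [o.volumeForm_robust' e] at h1
  have h2 : e.toBasis.det v = M.det := by
    rw [Module.Basis.det_apply, ← Matrix.det_transpose]
    congr 1
  rw [h2] at h1
  refine h1.trans ?_
  have h3 : ∀ i, ‖v i‖ ≤ E * (r : ℝ) ^ ((1 : ℝ) / 2) := by
    intro i
    rw [← Real.sqrt_eq_rpow, EuclideanSpace.norm_eq]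
    apply Real.sqrt_le_iff.mpr
    refine ⟨by positivity, ?_⟩
    rw [mul_pow, Real.sq_sqrt (by positivity)]
    calc ∑ j, ‖v i j‖ ^ 2 ≤ ∑ j : Fin r, E ^ 2 := by
          gcongr with j
          exact h i j
      _ = E ^ 2 * r := by simp [mul_comm]
  calc ∏ i, ‖v i‖ ≤ ∏ i : Fin r, E * (r : ℝ) ^ ((1 : ℝ) / 2) :=
        Finset.prod_le_prod (fun _ _ => norm_nonneg _) (fun i _ => h3 i)
    _ = E ^ r * (r : ℝ) ^ ((r : ℝ) / 2) := by
        rw [Finset.prod_const, Finset.card_univ, Fintype.card_fin, mul_pow,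
          ← Real.rpow_mul_natCast (by positivity)]
        congr 2
        ring

lemma exists_minor {ι κ : Type*} [Fintype ι] [DecidableEq ι] [Fintype κ]
    (A : Matrix ι κ ℚ) (h : LinearIndependent ℚ A.row) :
    ∃ g : ι → κ, (A.submatrix id g).det ≠ 0 := by
  obtain ⟨τ, a, ha, hsp, hli⟩ := exists_linearIndependent' ℚ A.col
  have : Finite τ := Finite.of_injective a ha
  have := Fintype.ofFinite τ
  have hc : Fintype.card τ = Fintype.card ι := by
    rw [← h.rank_matrix, Matrix.rank_eq_finrank_span_cols, ← hsp]
    exact linearIndependent_iff_card_eq_finrank_span.mp hli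
  let e := (Fintype.equivOfCardEq hc).symm
  refine ⟨a ∘ e, ?_⟩
  have h2 : LinearIndependent ℚ (A.submatrix id (a ∘ e)).col := hli.comp e e.injective
  have h3 := Matrix.linearIndependent_cols_iff_isUnit.mp h2
  exact ((Matrix.isUnit_iff_isUnit_det _).mp h3).ne_zero

theorem stmt_1 (m n : ℕ) (U : Matrix (Fin m) (Fin n) ℤ) (b : Fin m → ℤ) (H : ℝ)
    (hsol : ∃ y : Fin n → ℤ, U.mulVec y = b)
    (hU : ∀ i j, (|U i j| : ℝ) ≤ Real.exp H)
    (hb : ∀ i, (|b i| : ℝ) ≤ Real.exp H) :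
    ∃ y : Fin n → ℤ, U.mulVec y = b ∧
      ∀ i, (|y i| : ℝ) ≤ Real.exp (m * H) * (m : ℝ) ^ ((m : ℝ) / 2) := by
  classical
  rcases lt_or_ge H 0 with hH | hH
  · refine ⟨0, ?_, fun i => by simp; positivity⟩
    rw [Matrix.mulVec_zero]
    ext i
    have h1 := (hb i).trans_lt (Real.exp_lt_one_iff.mpr hH)
    have h2 : |b i| < 1 := by exact_mod_cast h1
    simpa using (Int.abs_lt_one_iff.mp h2).symm
  obtain ⟨y₀, hy₀⟩ := hsol
  let UQ : Matrix (Fin m) (Fin n) ℚ := U.map (Int.cast)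
  obtain ⟨τ, a, ha, hsp, hli⟩ := exists_linearIndependent' ℚ UQ.row
  have : Finite τ := Finite.of_injective a ha
  have := Fintype.ofFinite τ
  obtain ⟨r, ⟨e⟩⟩ : ∃ r, Nonempty (Fin r ≃ τ) := ⟨_, ⟨(Fintype.equivFin τ).symm⟩⟩
  let f : Fin r → Fin m := a ∘ e
  have hf : Function.Injective f := ha.comp e.injective
  have hrm : r ≤ m := by simpa using Fintype.card_le_of_injective f hf
  have hlif : LinearIndependent ℚ (UQ.submatrix f id).row := hli.comp e e.injective
  have hspf : Submodule.span ℚ (Set.range (UQ.row ∘ f)) = Submodule.span ℚ (Set.range UQ.row) := by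
    rw [← hsp]
    congr 1
    simp only [f, ← Function.comp_assoc]
    exact e.surjective.range_comp _
  set A := U.submatrix f id with hA
  have hrows : ∀ z : Fin n → ℤ, A *ᵥ z = 0 → U *ᵥ z = 0 := by
    intro z hz
    let φ : (Fin n → ℚ) →ₗ[ℚ] ℚ := ∑ j, (z j : ℚ) • LinearMap.proj j
    have hφ : ∀ i, φ (UQ.row i) = ((U *ᵥ z) i : ℤ) := by
      intro i
      simp [φ, UQ, Matrix.mulVec, dotProduct, mul_comm]
    have h1 : Submodule.span ℚ (Set.range (UQ.row ∘ f)) ≤ LinearMap.ker φ := by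
      rw [Submodule.span_le]
      rintro _ ⟨i, rfl⟩
      have h2 : (U *ᵥ z) (f i) = 0 := congrFun hz i
      simp [hφ, h2]
    rw [hspf] at h1
    ext i
    have h3 : UQ.row i ∈ LinearMap.ker φ := h1 (Submodule.subset_span ⟨i, rfl⟩)
    rw [LinearMap.mem_ker, hφ] at h3
    exact_mod_cast h3
  obtain ⟨g, hg⟩ := exists_minor _ hlif
  have hgZ : (A.submatrix id g).det ≠ 0 := by
    intro h0
    apply hg
    have h1 : (UQ.submatrix f id).submatrix id g = (A.submatrix id g).map (Int.cast) := rfl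
    rw [h1, ← Int.cast_det, h0, Int.cast_zero]
  have hA0 : A *ᵥ y₀ = b ∘ f := by
    rw [← hy₀]; rfl
  set R : ℝ := Real.exp H ^ r * (r : ℝ) ^ ((r : ℝ) / 2) with hR
  have hdet : ∀ M : Matrix (Fin r) (Fin r) ℤ, (∀ i j, |(M i j : ℝ)| ≤ Real.exp H) →
      |M.det| ≤ ⌊R⌋ := by
    intro M hM
    rw [Int.le_floor]
    have h1 := hadamard_fin r (M.map (Int.cast)) _ (Real.exp_nonneg H) hM
    rw [← Int.cast_det] at h1
    exact_mod_cast h1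
  obtain ⟨y, hy, hyb⟩ := core A (b ∘ f) y₀ hA0 ⟨g, hgZ⟩ ⌊R⌋
    (fun g => hdet _ fun i j => hU _ _)
    (fun g i => hdet _ fun k k' => by
      by_cases h : k' = i
      · subst h; simpa using hb _
      · simpa [h, hA] using hU (f k) (g k'))
  refine ⟨y, ?_, ?_⟩
  · have h1 := hrows (y - y₀) (by rw [Matrix.mulVec_sub, hy, hA0, sub_self])
    rw [Matrix.mulVec_sub, hy₀, sub_eq_zero] at h1
    exact h1
  · intro i
    have h1 : ((|y i| : ℤ) : ℝ) ≤ R := Int.le_floor.mp (hyb i)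
    rw [Int.cast_abs] at h1
    refine h1.trans ?_
    rw [hR, ← Real.exp_nat_mul]
    rcases Nat.eq_zero_or_pos r with h0 | hr
    · subst h0
      simp only [Nat.cast_zero, zero_mul, Real.exp_zero, zero_div, Real.rpow_zero, mul_one]
      have h2 : 1 ≤ Real.exp (m * H) := Real.one_le_exp (by positivity)
      have h3 : 1 ≤ (m : ℝ) ^ ((m : ℝ) / 2) := by
        rcases Nat.eq_zero_or_pos m with h0 | hm
        · simp [h0]
        · exact Real.one_le_rpow (by exact_mod_cast hm) (by positivity)
      nlinarith
    · have h4 : (r : ℝ) ≤ m := by exact_mod_cast hrm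
      have h5 : (1 : ℝ) ≤ m := by exact_mod_cast hr.trans_le hrm
      have h6 : (r : ℝ) ^ ((r : ℝ) / 2) ≤ (m : ℝ) ^ ((m : ℝ) / 2) :=
        (Real.rpow_le_rpow (by positivity) h4 (by positivity)).trans
          (Real.rpow_le_rpow_of_exponent_le h5 (by linarith))
      gcongr
end

section
/- Let $m \ge 1$, let $\alpha_1, \ldots, \alpha_m$ be distinct algebraic numbers such that $G(X) := \prod_{i=1}^m (X - \alpha_i)$ has integer coefficients. Let $q, p_0, \ldots, p_{m-1}$ be integers with $\gcd(q, p_0, \ldots, p_{m-1}) = 1$ and $q \neq 0$, and set $\beta_i := \sum_{j=0}^{m-1} (p_j/q)\,\alpha_i^j$ for $i = 1, \ldots, m$. Then $\log \max(|q|, |p_0|, \ldots, |p_{m-1}|) \le 2m^2 + (m-1) h(G) + \sum_{j=1}^m h(\beta_j)$, where $h(G)$ is the logarithmic height of the polynomial $G$ and $h(\beta_j)$ is the absolute logarithmic Weil height. -/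
open NumberField
open scoped nonZeroDivisors

/-- The absolute logarithmic projective (Weil) height of a nonzero tuple of elements of a
number field `L`: the archimedean contribution is computed with the infinite places
(with their multiplicities), and the total non-archimedean contribution equals minus the
logarithm of the absolute norm of the fractional ideal generated by the entries. -/
noncomputable def projHeight (L : Type*) [Field L] [NumberField L] {n : ℕ}
    (x : Fin (n + 1) → L) : ℝ :=
  ((∑ w : InfinitePlace L,
      (w.mult : ℝ) * Real.log (Finset.univ.sup' Finset.univ_nonempty (fun i => w (x i))))
    - Real.log ((FractionalIdeal.absNorm
        (∑ i, FractionalIdeal.spanSingleton (RingOfIntegers L)⁰ (x i)) : ℚ))) /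
    (Module.finrank ℚ L)

/-- The absolute logarithmic Weil height of an element of a number field. -/
noncomputable def numHeight {L : Type*} [Field L] [NumberField L] (α : L) : ℝ :=
  projHeight L ![1, α]

/-- The logarithmic height of an integer polynomial: the logarithm of the maximum of the
absolute values of its coefficients. -/
noncomputable def polyLogHeight (G : Polynomial ℤ) : ℝ :=
  Real.log ((G.support.sup fun n => (G.coeff n).natAbs : ℕ) : ℝ)

lemma aux_det_abs {L : Type*} [Field L] {m : ℕ} (w : AbsoluteValue L ℝ)
    (A : Matrix (Fin m) (Fin m) L) (B : Fin m → ℝ) (h : ∀ i k, w (A i k) ≤ B i) :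
    w A.det ≤ (m.factorial : ℝ) * ∏ i, B i := by
  rw [Matrix.det_apply]
  refine (w.sum_le _ _).trans ?_
  have key : ∀ σ ∈ (Finset.univ : Finset (Equiv.Perm (Fin m))),
      w (Equiv.Perm.sign σ • ∏ i, A (σ i) i) ≤ ∏ i, B i := by
    intro σ _
    have h1 : w (Equiv.Perm.sign σ • ∏ i, A (σ i) i) = w (∏ i, A (σ i) i) := by
      rcases Int.units_eq_one_or (Equiv.Perm.sign σ) with h | h <;> simp [h]
    rw [h1, map_prod, ← Equiv.prod_comp σ B]
    exact Finset.prod_le_prod (fun i _ => w.nonneg _) (fun i _ => h _ _)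
  refine (Finset.sum_le_card_nsmul _ _ _ key).trans ?_
  simp [Fintype.card_perm]

lemma aux_prod_mem {L : Type*} [Field L] [NumberField L] {ι : Type*} (s : Finset ι)
    (J : ι → FractionalIdeal (RingOfIntegers L)⁰ L) (a : ι → L) (h : ∀ i ∈ s, a i ∈ J i) :
    ∏ i ∈ s, a i ∈ ∏ i ∈ s, J i := by
  classical
  induction s using Finset.induction_on with
  | empty => simpa using FractionalIdeal.one_mem_one _
  | insert x s hx ih =>
    rw [Finset.prod_insert hx, Finset.prod_insert hx]
    exact FractionalIdeal.mul_mem_mul (h x (by simp))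
      (ih fun i hi => h i (Finset.mem_insert_of_mem hi))

lemma aux_sum_mem {L : Type*} [Field L] [NumberField L] {ι : Type*} (s : Finset ι)
    (J : FractionalIdeal (RingOfIntegers L)⁰ L) (a : ι → L) (h : ∀ i ∈ s, a i ∈ J) :
    ∑ i ∈ s, a i ∈ J := by
  have := Submodule.sum_mem (J : Submodule (RingOfIntegers L) L) (t := s) (f := a) (by simpa using h)
  simpa using this

lemma aux_smul_mem {L : Type*} [Field L] [NumberField L]
    (J : FractionalIdeal (RingOfIntegers L)⁰ L) (a : L) (z : L) (hz : IsIntegral ℤ z) (h : a ∈ J) :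
    z * a ∈ J := by
  have := Submodule.smul_mem (J : Submodule (RingOfIntegers L) L) (⟨z, hz⟩ : RingOfIntegers L)
    (by simpa using h)
  have h2 : (⟨z, hz⟩ : RingOfIntegers L) • a = z * a := rfl
  rw [← h2]
  exact this

lemma aux_det_mem {L : Type*} [Field L] [NumberField L] {m : ℕ}
    (A : Matrix (Fin m) (Fin m) L) (J : Fin m → FractionalIdeal (RingOfIntegers L)⁰ L)
    (h : ∀ i k, A i k ∈ J i) : A.det ∈ ∏ i, J i := by
  rw [Matrix.det_apply]
  refine aux_sum_mem _ _ _ fun σ _ => ?_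
  have h1 : ∏ i, A (σ i) i ∈ ∏ i, J i := by
    rw [← Equiv.prod_comp σ J]
    exact aux_prod_mem _ _ _ fun i _ => h _ _
  rcases Int.units_eq_one_or (Equiv.Perm.sign σ) with h | h
  · simpa [h] using h1
  · have := aux_smul_mem _ _ (-1) (isIntegral_one.neg) h1
    simpa [h] using this

lemma aux_absNorm_le {L : Type*} [Field L] [NumberField L]
    (J : FractionalIdeal (RingOfIntegers L)⁰ L) (hJ : J ≠ 0) (x : L) (hx : x ≠ 0) (h : x ∈ J) :
    FractionalIdeal.absNorm J ≤ |Algebra.norm ℚ x| := by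
  have h1 : FractionalIdeal.spanSingleton (RingOfIntegers L)⁰ x ≤ J := by
    rwa [FractionalIdeal.spanSingleton_le_iff_mem]
  rw [← FractionalIdeal.absNorm_span_singleton (RingOfIntegers L)]
  have h2 : FractionalIdeal.spanSingleton (RingOfIntegers L)⁰ x * J⁻¹ ≤ 1 := by
    calc _ ≤ J * J⁻¹ := by gcongr
      _ = 1 := mul_inv_cancel₀ hJ
  obtain ⟨I, hI⟩ := FractionalIdeal.le_one_iff_exists_coeIdeal.mp h2
  have h3 : FractionalIdeal.spanSingleton (RingOfIntegers L)⁰ x = I * J := by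
    rw [hI, mul_assoc, inv_mul_cancel₀ hJ, mul_one]
  have h4 : I ≠ ⊥ := by
    rintro rfl
    simp at h3
    exact hx (FractionalIdeal.spanSingleton_eq_zero_iff.mp h3)
  rw [h3, map_mul, FractionalIdeal.coeIdeal_absNorm]
  have h5 : (1 : ℚ) ≤ Ideal.absNorm I := by
    have : Ideal.absNorm I ≠ 0 := by simpa [Ideal.absNorm_eq_zero_iff] using h4
    exact_mod_cast Nat.one_le_iff_ne_zero.mpr this
  have := FractionalIdeal.absNorm_nonneg J
  nlinarith

lemma aux_deg {L : Type*} [Field L] [NumberField L] {m : ℕ}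
    (α : Fin m → L) (G : Polynomial ℤ)
    (hG : G.map (algebraMap ℤ L) = ∏ i, (Polynomial.X - Polynomial.C (α i))) :
    G.Monic ∧ G.natDegree = m := by
  have hinj : Function.Injective (algebraMap ℤ L) := FaithfulSMul.algebraMap_injective ℤ L
  refine ⟨?_, ?_⟩
  · apply Polynomial.monic_of_injective hinj
    rw [hG]
    exact Polynomial.monic_prod_of_monic _ _ fun i _ => Polynomial.monic_X_sub_C _
  · rw [← Polynomial.natDegree_map_eq_of_injective hinj, hG, Polynomial.natDegree_prod_of_monic _ _
      fun i _ => Polynomial.monic_X_sub_C _]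
    simp

lemma aux_mahler {L : Type*} [Field L] [NumberField L] {m : ℕ}
    (α : Fin m → L) (G : Polynomial ℤ)
    (hG : G.map (algebraMap ℤ L) = ∏ i, (Polynomial.X - Polynomial.C (α i)))
    (w : InfinitePlace L) :
    ∏ i, max 1 (w (α i)) ≤ (m + 1 : ℝ) * ((G.support.sup fun n => (G.coeff n).natAbs : ℕ) : ℝ) := by
  obtain ⟨hmon, hdeg⟩ := aux_deg α G hG
  have h1 : G.map (algebraMap ℤ ℂ) =
      ∏ i, (Polynomial.X - Polynomial.C (w.embedding (α i))) := by
    have := congrArg (Polynomial.map w.embedding) hG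
    rw [Polynomial.map_map, Polynomial.map_prod] at this
    simp only [Polynomial.map_sub, Polynomial.map_X, Polynomial.map_C] at this
    rw [← this]
    congr 1
    exact RingHom.ext_int _ _
  have h2 : (G.map (algebraMap ℤ ℂ)).mahlerMeasure = ∏ i, max 1 (w (α i)) := by
    rw [h1]
    have := Polynomial.prod_mahlerMeasure_eq_mahlerMeasure_prod
      ((Finset.univ : Finset (Fin m)).val.map
        (fun i => (Polynomial.X - Polynomial.C (w.embedding (α i)))))
    rw [Multiset.map_map] at this
    refine this.trans ?_
    change ∏ i, _ = _
    refine Finset.prod_congr rfl fun i _ => ?_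
    simp [Polynomial.mahlerMeasure_X_sub_C, InfinitePlace.norm_embedding_eq]
  rw [← h2]
  refine (Polynomial.mahlerMeasure_le_sum_norm_coeff _).trans ?_
  rw [Polynomial.sum_over_range _ (by simp)]
  refine (Finset.sum_le_card_nsmul _ _
    ((G.support.sup fun n => (G.coeff n).natAbs : ℕ) : ℝ) ?_).trans ?_
  · intro n _
    have : ‖(G.map (algebraMap ℤ ℂ)).coeff n‖ = ((G.coeff n).natAbs : ℝ) := by
      simp [Nat.cast_natAbs]
    rw [this]
    norm_cast
    by_cases hn : n ∈ G.support
    · exact Finset.le_sup (f := fun n => (G.coeff n).natAbs) hn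
    · simp [Polynomial.notMem_support_iff.mp hn]
  · rw [hmon.natDegree_map, hdeg]
    simp

lemma aux_H (G : Polynomial ℤ) (hmon : G.Monic) :
    (1 : ℝ) ≤ ((G.support.sup fun n => (G.coeff n).natAbs : ℕ) : ℝ) := by
  have : G.natDegree ∈ G.support := by
    rw [Polynomial.mem_support_iff]
    have := hmon.coeff_natDegree
    simp [this]
  have h := Finset.le_sup (f := fun n => (G.coeff n).natAbs) this
  simp only [hmon.coeff_natDegree] at h
  exact_mod_cast h

lemma aux_const (m : ℕ) (hm : 1 ≤ m) :
    Real.log (m.factorial : ℝ) + ((m : ℝ) - 1) * Real.log (m + 1) ≤ 2 * (m : ℝ) ^ 2 := by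
  have hm' : (1 : ℝ) ≤ m := by exact_mod_cast hm
  have h1 : Real.log (m.factorial : ℝ) ≤ m * Real.log m := by
    rw [← Real.log_pow]
    apply Real.log_le_log
    · exact_mod_cast m.factorial_pos
    · exact_mod_cast m.factorial_le_pow
  have h2 : Real.log m ≤ m := (Real.log_le_sub_one_of_pos (by linarith)).trans (by linarith)
  have h3 : Real.log (m + 1) ≤ m := (Real.log_le_sub_one_of_pos (by linarith)).trans (by linarith)
  nlinarith

/-- Let `α₁, …, α_m` be distinct algebraic numbers with
`G(X) = ∏ (X - αᵢ) ∈ ℤ[X]`, let `q, p₀, …, p_{m-1}` be coprime integers with `q ≠ 0`,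
and `βᵢ = ∑ⱼ (pⱼ/q) αᵢʲ`.  Then
`log max(|q|,|p₀|,…,|p_{m-1}|) ≤ 2m² + (m-1) h(G) + ∑ h(βⱼ)`. -/
theorem stmt_5 (L : Type*) [Field L] [NumberField L] (m : ℕ) (hm : 1 ≤ m)
    (α : Fin m → L) (hα : Function.Injective α) (G : Polynomial ℤ)
    (hG : G.map (algebraMap ℤ L) = ∏ i, (Polynomial.X - Polynomial.C (α i)))
    (q : ℤ) (p : Fin m → ℤ) (hq : q ≠ 0)
    (hgcd : Finset.univ.gcd (Fin.cons q p : Fin (m + 1) → ℤ) = 1)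
    (β : Fin m → L)
    (hβ : ∀ i, β i = ∑ j : Fin m, ((p j : L) / (q : L)) * α i ^ (j : ℕ)) :
    Real.log ((Finset.univ.sup (fun j : Fin (m + 1) => ((Fin.cons q p : Fin (m + 1) → ℤ) j).natAbs) : ℕ) : ℝ) ≤
      2 * (m : ℝ) ^ 2 + ((m : ℝ) - 1) * polyLogHeight G + ∑ i, numHeight (β i) := by
  classical
  obtain ⟨hmon, hdeg⟩ := aux_deg α G hG
  have hm' : (1 : ℝ) ≤ m := by exact_mod_cast hm
  have hqL : (q : L) ≠ 0 := by exact_mod_cast hq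
  have hint : ∀ i, IsIntegral ℤ (α i) := by
    intro i
    refine ⟨G, hmon, ?_⟩
    rw [← Polynomial.eval_map, hG, Polynomial.eval_prod]
    exact Finset.prod_eq_zero (Finset.mem_univ i) (by simp)
  set P : Fin (m + 1) → ℤ := Fin.cons q p with hP
  set H : ℕ := (G.support.sup fun n => (G.coeff n).natAbs : ℕ) with hH
  have hH1 : (1 : ℝ) ≤ (H : ℝ) := aux_H G hmon
  set N : ℕ := Finset.univ.sup (fun j : Fin (m + 1) => (P j).natAbs) with hN
  have hN1 : 1 ≤ N := by
    have h := Finset.le_sup (f := fun j : Fin (m + 1) => (P j).natAbs) (Finset.mem_univ 0)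
    have h0 : P 0 = q := rfl
    simp only [h0] at h
    have : 1 ≤ q.natAbs := Int.natAbs_pos.mpr hq
    exact this.trans h
  set V : Matrix (Fin m) (Fin m) L := Matrix.vandermonde α with hV
  have hD : V.det ≠ 0 := Matrix.det_vandermonde_ne_zero_iff.mpr hα
  -- Cramer rule
  have hcr : ∀ j, V.det / q * p j = (V.updateCol j β).det := by
    intro j
    have hb : β = V.mulVec (fun j => (p j : L) / q) := by
      ext i
      rw [hβ, Matrix.mulVec, dotProduct]
      refine Finset.sum_congr rfl fun j _ => ?_
      rw [hV, Matrix.vandermonde_apply, mul_comm]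
    rw [← Matrix.cramer_apply, Matrix.cramer_eq_adjugate_mulVec, hb, Matrix.mulVec_mulVec,
      Matrix.adjugate_mul, Matrix.smul_mulVec, Matrix.one_mulVec, Pi.smul_apply, smul_eq_mul]
    ring
  set x : L := V.det / q with hx
  have hx0 : x ≠ 0 := div_ne_zero hD hqL
  -- every `x * P j` is a determinant with rows of controlled size
  have hdet : ∀ j : Fin (m + 1), ∃ A : Matrix (Fin m) (Fin m) L, x * (P j : L) = A.det ∧
      ∀ i k, A i k = β i ∨ ∃ l : ℕ, l ≤ m - 1 ∧ A i k = α i ^ l := by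
    intro j
    refine Fin.cases ?_ (fun j => ?_) j
    · refine ⟨V, ?_, fun i k => Or.inr ⟨k, by omega, rfl⟩⟩
      change x * (q : L) = _
      rw [hx]
      field_simp
    · refine ⟨V.updateCol j β, hcr j, fun i k => ?_⟩
      rw [Matrix.updateCol_apply]
      split_ifs
      · exact Or.inl rfl
      · exact Or.inr ⟨k, by omega, rfl⟩
  -- finite places
  set J : Fin m → FractionalIdeal (RingOfIntegers L)⁰ L := fun i =>
    ∑ k : Fin 2, FractionalIdeal.spanSingleton (RingOfIntegers L)⁰ ((![1, β i] : Fin 2 → L) k)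
    with hJ
  have hJe : ∀ i, J i = FractionalIdeal.spanSingleton (RingOfIntegers L)⁰ 1 +
      FractionalIdeal.spanSingleton (RingOfIntegers L)⁰ (β i) := fun i => by
    simp [hJ, Fin.sum_univ_two]
  have hJ1 : ∀ i, (1 : L) ∈ J i := fun i => by
    rw [hJe, ← FractionalIdeal.spanSingleton_le_iff_mem]
    exact le_self_add
  have hJβ : ∀ i, β i ∈ J i := fun i => by
    rw [hJe, ← FractionalIdeal.spanSingleton_le_iff_mem]
    exact le_add_self
  have hJ0 : ∀ i, J i ≠ 0 := fun i h => by
    have := hJ1 i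
    rw [h] at this
    simp at this
  have hxP : ∀ j, x * (P j : L) ∈ ∏ i, J i := by
    intro j
    obtain ⟨A, hA, hAe⟩ := hdet j
    rw [hA]
    refine aux_det_mem _ _ fun i k => ?_
    rcases hAe i k with h | ⟨l, -, h⟩
    · rw [h]; exact hJβ i
    · rw [h, ← mul_one (α i ^ l)]
      exact aux_smul_mem _ _ _ ((hint i).pow l) (hJ1 i)
  have hxm : x ∈ ∏ i, J i := by
    obtain ⟨g, hg⟩ := Finset.gcd_eq_sum_mul Finset.univ P
    rw [hgcd] at hg
    have h1 : x = ∑ j, (g j : L) * (x * (P j : L)) := by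
      have : (1 : L) = ∑ j, (P j : L) * (g j : L) := by exact_mod_cast congrArg (Int.cast : ℤ → L) hg
      calc x = x * 1 := (mul_one x).symm
        _ = _ := by
          rw [this, Finset.mul_sum]
          exact Finset.sum_congr rfl fun j _ => by ring
    rw [h1]
    refine aux_sum_mem _ _ _ fun j _ => aux_smul_mem _ _ _ ?_ (hxP j)
    exact isIntegral_algebraMap (R := ℤ) (A := L) (x := g j)
  have hnorm : ∏ i, FractionalIdeal.absNorm (J i) ≤ |Algebra.norm ℚ x| := by
    rw [← map_prod]
    exact aux_absNorm_le _ (Finset.prod_ne_zero_iff.mpr fun i _ => hJ0 i) x hx0 hxm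
  have hJpos : ∀ i, (0 : ℚ) < FractionalIdeal.absNorm (J i) := fun i =>
    lt_of_le_of_ne (FractionalIdeal.absNorm_nonneg _)
      (Ne.symm (by rw [Ne, FractionalIdeal.absNorm_eq_zero_iff]; exact hJ0 i))
  have hfin : ∑ i, Real.log ((FractionalIdeal.absNorm (J i) : ℚ) : ℝ) ≤
      ∑ w : InfinitePlace L, (w.mult : ℝ) * Real.log (w x) := by
    rw [← Real.log_prod (fun i _ => by exact_mod_cast (hJpos i).ne')]
    have h1 : ∑ w : InfinitePlace L, (w.mult : ℝ) * Real.log (w x) =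
        Real.log ((|Algebra.norm ℚ x| : ℚ) : ℝ) := by
      rw [← InfinitePlace.prod_eq_abs_norm, Real.log_prod]
      · simp [Real.log_pow]
      · intro w _
        exact pow_ne_zero _ (InfinitePlace.pos_iff.mpr hx0).ne'
    rw [h1]
    apply Real.log_le_log
    · exact Finset.prod_pos fun i _ => by exact_mod_cast hJpos i
    · exact_mod_cast hnorm
  -- infinite places
  have hinf : ∀ w : InfinitePlace L, Real.log N + Real.log (w x) ≤
      2 * (m : ℝ) ^ 2 + ((m : ℝ) - 1) * Real.log H + ∑ i, Real.log (max 1 (w (β i))) := by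
    intro w
    have hwx : 0 < w x := InfinitePlace.pos_iff.mpr hx0
    obtain ⟨j, -, hj⟩ := Finset.exists_mem_eq_sup Finset.univ Finset.univ_nonempty
      (fun j : Fin (m + 1) => (P j).natAbs)
    have hwP : w (P j : L) = (N : ℝ) := by
      rw [hN, hj, ← InfinitePlace.norm_embedding_eq]
      simp [Nat.cast_natAbs]
    obtain ⟨A, hA, hAe⟩ := hdet j
    have hb : w (x * (P j : L)) ≤ (m.factorial : ℝ) *
        ∏ i, (max 1 (w (α i)) ^ (m - 1) * max 1 (w (β i))) := by
      rw [hA]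
      refine aux_det_abs w.1 A _ fun i k => ?_
      have ha1 : 1 ≤ max 1 (w (α i)) := le_max_left _ _
      have hb1 : 1 ≤ max 1 (w (β i)) := le_max_left _ _
      rcases hAe i k with h | ⟨l, hl, h⟩
      · rw [h]
        calc w (β i) ≤ 1 * max 1 (w (β i)) := by rw [one_mul]; exact le_max_right _ _
          _ ≤ _ := by gcongr; exact one_le_pow₀ ha1
      · rw [h, map_pow]
        calc (w (α i)) ^ l ≤ max 1 (w (α i)) ^ l := by
              gcongr
              exact le_max_right _ _
          _ ≤ max 1 (w (α i)) ^ (m - 1) := pow_le_pow_right₀ ha1 hl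
          _ ≤ _ := le_mul_of_one_le_right (by positivity) hb1
    rw [Finset.prod_mul_distrib, Finset.prod_pow, map_mul, hwP] at hb
    have hM := aux_mahler α G hG w
    rw [← hH] at hM
    have hb2 : w x * N ≤ (m.factorial : ℝ) * (((m + 1 : ℝ) * H) ^ (m - 1) *
        ∏ i, max 1 (w (β i))) := by
      refine hb.trans ?_
      gcongr
    have hNpos : (0 : ℝ) < N := by exact_mod_cast hN1
    have hf : (0 : ℝ) < m.factorial := by exact_mod_cast m.factorial_pos
    have hmm : (0 : ℝ) < (m : ℝ) + 1 := by linarith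
    have hHp : (0 : ℝ) < H := by linarith
    have hpr : 0 < ∏ i, max 1 (w (β i)) := Finset.prod_pos fun i _ => by positivity
    have hlog := Real.log_le_log (by positivity) hb2
    rw [Real.log_mul hwx.ne' hNpos.ne', Real.log_mul hf.ne' (by positivity),
      Real.log_mul (by positivity) hpr.ne', Real.log_pow, Real.log_mul hmm.ne' hHp.ne',
      Real.log_prod (fun i _ => by positivity), Nat.cast_sub hm, Nat.cast_one] at hlog
    have := aux_const m hm
    linarith
  -- conclusion
  have hd : (0 : ℝ) < Module.finrank ℚ L := by exact_mod_cast Module.finrank_pos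
  have hmult : ∑ w : InfinitePlace L, (w.mult : ℝ) = Module.finrank ℚ L := by
    exact_mod_cast InfinitePlace.sum_mult_eq (K := L)
  have hnum : ∀ i, numHeight (β i) * Module.finrank ℚ L =
      ∑ w : InfinitePlace L, (w.mult : ℝ) * Real.log (max 1 (w (β i))) -
        Real.log ((FractionalIdeal.absNorm (J i) : ℚ) : ℝ) := by
    intro i
    rw [numHeight, projHeight, div_mul_cancel₀ _ hd.ne']
    congr 1
    refine Finset.sum_congr rfl fun w _ => ?_
    congr 2
    apply le_antisymm
    · refine Finset.sup'_le _ _ fun k _ => ?_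
      fin_cases k <;> simp
    · refine max_le ?_ ?_
      · exact le_trans (by simp) (Finset.le_sup' (fun k => w ((![1, β i] : Fin 2 → L) k))
          (Finset.mem_univ 0))
      · exact le_trans (by simp) (Finset.le_sup' (fun k => w ((![1, β i] : Fin 2 → L) k))
          (Finset.mem_univ 1))
  have hsum : ∑ w : InfinitePlace L, (w.mult : ℝ) * (Real.log N + Real.log (w x)) ≤
      ∑ w : InfinitePlace L, (w.mult : ℝ) * (2 * (m : ℝ) ^ 2 + ((m : ℝ) - 1) * Real.log H +
        ∑ i, Real.log (max 1 (w (β i)))) :=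
    Finset.sum_le_sum fun w _ => mul_le_mul_of_nonneg_left (hinf w) (by positivity)
  simp only [mul_add, Finset.sum_add_distrib, ← Finset.sum_mul, hmult] at hsum
  have hswap : ∑ w : InfinitePlace L, (w.mult : ℝ) * ∑ i, Real.log (max 1 (w (β i))) =
      (∑ i, numHeight (β i)) * Module.finrank ℚ L +
        ∑ i, Real.log ((FractionalIdeal.absNorm (J i) : ℚ) : ℝ) := by
    rw [Finset.sum_mul, ← Finset.sum_add_distrib]
    simp only [Finset.mul_sum]
    rw [Finset.sum_comm]
    exact Finset.sum_congr rfl fun i _ => by rw [hnum]; ring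
  rw [hswap] at hsum
  have hpoly : polyLogHeight G = Real.log H := rfl
  rw [hpoly]
  refine le_of_mul_le_mul_right ?_ hd
  linarith
end

section
/- Let $L$ be a number field of degree $d_L$ over $\mathbb{Q}$, with class number $h_L$, regulator $R_L$ and discriminant $\Delta_L$. Then $h_L R_L \le |\Delta_L|^{1/2} (\log^* |\Delta_L|)^{d_L - 1}$, where $\log^* x := \max(1, \log x)$. -/
open NumberField

/-- auxiliary primitive of `log (y/t)^r / r!` -/
noncomputable def louPhi (y : ℝ) (r : ℕ) (t : ℝ) : ℝ :=
  t * ∑ j ∈ Finset.range (r + 1), Real.log (y / t) ^ j / (j.factorial : ℝ)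

lemma louPhi_hasDerivAt {y : ℝ} (hy : 0 < y) (r : ℕ) {t : ℝ} (ht : 0 < t) :
    HasDerivAt (louPhi y r) (Real.log (y / t) ^ r / (r.factorial : ℝ)) t := by
  have hl : HasDerivAt (fun t : ℝ => Real.log (y / t)) (-1 / t) t := by
    have h1 : HasDerivAt (fun t : ℝ => y / t) (-y / t ^ 2) t := by
      have := (hasDerivAt_inv ht.ne').const_mul y
      simpa [div_eq_mul_inv] using! this
    have h2 := h1.log (by positivity)
    convert h2 using 1
    field_simp
  induction r with
  | zero =>
    have := hasDerivAt_id t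
    unfold louPhi
    simpa using! this
  | succ r ih =>
    have h3 : HasDerivAt (fun t : ℝ => t * (Real.log (y / t) ^ (r + 1) / ((r + 1).factorial : ℝ)))
        (Real.log (y / t) ^ (r + 1) / ((r + 1).factorial : ℝ)
          - Real.log (y / t) ^ r / (r.factorial : ℝ)) t := by
      have := (hasDerivAt_id t).mul ((hl.pow (r + 1)).div_const ((r + 1).factorial : ℝ))
      convert! this using 1
      have h5 : ((r + 1).factorial : ℝ) = (r + 1) * r.factorial := by
        rw [Nat.factorial_succ]; push_cast; ring
      have : (r.factorial : ℝ) ≠ 0 := by positivity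
      have : (r : ℝ) + 1 ≠ 0 := by positivity
      simp only [id, h5]
      push_cast
      simp
      field_simp
      ring
    have h4 := ih.add h3
    convert! h4 using 1
    · funext t
      simp only [louPhi, Pi.add_apply]
      rw [Finset.sum_range_succ _ (r + 1)]
      ring
    · ring

lemma lou_sum_log_aux {y : ℝ} (r : ℕ) (N : ℕ) (hN : (N : ℝ) ≤ y) (h1 : 1 ≤ N) :
    ∑ m ∈ Finset.Icc 1 N, Real.log (y / m) ^ r / (r.factorial : ℝ) ≤ louPhi y r N := by
  induction N, h1 using Nat.le_induction with
  | base =>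
    simp only [Finset.Icc_self, Finset.sum_singleton, louPhi]
    simp only [Nat.cast_one, one_mul]
    have hl : 0 ≤ Real.log (y / 1) := Real.log_nonneg (by simpa using hN)
    exact Finset.single_le_sum (f := fun j => Real.log (y / 1) ^ j / (j.factorial : ℝ))
      (fun i _ => by positivity) (Finset.mem_range.2 (Nat.lt_succ_self r))
  | succ N h1 ih =>
    have hN' : (N : ℝ) + 1 ≤ y := by exact_mod_cast hN
    have ih := ih (by linarith)
    rw [Finset.sum_Icc_succ_top (by omega)]
    have hN0 : (0 : ℝ) < N := by exact_mod_cast h1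
    have hy : 0 < y := by linarith
    obtain ⟨c, hc, hc'⟩ := exists_hasDerivAt_eq_slope (louPhi y r)
      (fun t => Real.log (y / t) ^ r / (r.factorial : ℝ)) (a := (N : ℝ)) (b := (N : ℝ) + 1)
      (by linarith)
      (fun t ht => (louPhi_hasDerivAt hy r (by linarith [ht.1])).continuousAt.continuousWithinAt)
      (fun t ht => louPhi_hasDerivAt hy r (by linarith [ht.1]))
    have hc0 : 0 < c := by linarith [hc.1]
    have h2 : Real.log (y / ((N : ℝ) + 1)) ^ r / (r.factorial : ℝ)
        ≤ Real.log (y / c) ^ r / (r.factorial : ℝ) := by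
      have : 0 ≤ Real.log (y / ((N : ℝ) + 1)) :=
        Real.log_nonneg (by rw [le_div_iff₀ (by positivity)]; linarith)
      have h3 : y / ((N : ℝ) + 1) ≤ y / c := by
        apply div_le_div_of_nonneg_left hy.le hc0 hc.2.le
      gcongr
    rw [hc'] at h2
    push_cast
    have : (N : ℝ) + 1 - N = 1 := by ring
    rw [this, div_one] at h2
    linarith

lemma louPhi_le {y : ℝ} (r : ℕ) {t : ℝ} (ht : 0 < t) (hty : t ≤ y) : louPhi y r t ≤ y := by
  have hl : 0 ≤ Real.log (y / t) := Real.log_nonneg (by rw [le_div_iff₀ ht]; linarith)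
  have := Real.sum_le_exp_of_nonneg hl (r + 1)
  rw [Real.exp_log (by have := ht.trans_le hty; positivity)] at this
  calc louPhi y r t ≤ t * (y / t) := by unfold louPhi; gcongr
    _ = y := by field_simp

lemma lou_sum_log {y X : ℝ} (r : ℕ) (hy : 0 ≤ y) (hX : y ≤ X) (hX1 : 1 ≤ X) (N : ℕ)
    (hN : (N : ℝ) ≤ y) :
    ∑ m ∈ Finset.Icc 1 N, Real.log (y / m) ^ r / (r.factorial : ℝ) ≤
      y * min 1 (Real.log X) ^ r := by
  have hlX := Real.log_nonneg hX1
  rcases Nat.eq_zero_or_pos N with rfl | h1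
  · simp; positivity
  have hy1 : 1 ≤ y := le_trans (by exact_mod_cast h1) hN
  rcases le_total 1 (Real.log X) with h | h
  · rw [min_eq_left h]
    simpa using (lou_sum_log_aux r N hN h1).trans (louPhi_le r (by exact_mod_cast h1) hN)
  · rw [min_eq_right h]
    calc _ ≤ ∑ m ∈ Finset.Icc 1 N, Real.log X ^ r := by
          apply Finset.sum_le_sum
          intro m hm
          rw [Finset.mem_Icc] at hm
          have hm1 : (1 : ℝ) ≤ m := by exact_mod_cast hm.1
          have hmy : (m : ℝ) ≤ y := le_trans (by exact_mod_cast hm.2) hN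
          have h0 : 0 ≤ Real.log (y / m) :=
            Real.log_nonneg (by rw [le_div_iff₀ (by linarith)]; linarith)
          have h2 : y / m ≤ X := (div_le_self hy hm1).trans hX
          have hf : (1 : ℝ) ≤ r.factorial := by exact_mod_cast Nat.one_le_iff_ne_zero.2 (Nat.factorial_ne_zero r)
          refine (div_le_self (by positivity) hf).trans ?_
          gcongr
      _ = N * Real.log X ^ r := by simp
      _ ≤ _ := by gcongr

lemma lou_tuple_sum {β : Type*} {k : ℕ} (B : Finset β) (Nm : β → ℕ) (g : β → Fin (k + 1) → ℕ)
    (inj : Set.InjOn g B) (hprod : ∀ b ∈ B, ∏ i, g b i = Nm b) (hpos : ∀ b ∈ B, 0 < Nm b)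
    (x : ℝ) (hx1 : 1 ≤ x) (hx : ∀ b ∈ B, (Nm b : ℝ) ≤ x) (r : ℕ) :
    ∑ b ∈ B, Real.log (x / Nm b) ^ r / (r.factorial : ℝ) ≤
      x * (1 + Real.log x) ^ k * min 1 (Real.log x) ^ r := by
  classical
  set N := ⌊x⌋₊ with hNdef
  set P := Fintype.piFinset (fun _ : Fin k => Finset.Icc 1 N) with hP
  have hPpos : ∀ m ∈ P, 1 ≤ ∏ i, m i := by
    intro m hm
    rw [hP, Fintype.mem_piFinset] at hm
    exact Finset.one_le_prod' (fun i _ => (Finset.mem_Icc.1 (hm i)).1)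
  set T : Finset (Σ _ : Fin k → ℕ, ℕ) :=
    P.sigma (fun m => Finset.Icc 1 ⌊x / ((∏ i, m i : ℕ) : ℝ)⌋₊) with hT
  set F : (Σ _ : Fin k → ℕ, ℕ) → ℝ := fun p =>
    Real.log (x / ((∏ i, p.1 i : ℕ) : ℝ) / p.2) ^ r / (r.factorial : ℝ) with hF
  have hlx := Real.log_nonneg hx1
  have hentry : ∀ b ∈ B, ∀ i, 1 ≤ g b i := by
    intro b hb i
    by_contra h
    have h0 : g b i = 0 := by omega
    have := hpos b hb
    rw [← hprod b hb, Finset.prod_eq_zero (Finset.mem_univ i) h0] at this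
    omega
  have hentry2 : ∀ b ∈ B, ∀ i, g b i ≤ N := by
    intro b hb i
    apply Nat.le_floor
    refine le_trans ?_ (hx b hb)
    rw [← hprod b hb]
    exact_mod_cast Nat.le_of_dvd (by rw [hprod b hb]; exact hpos b hb)
      (Finset.dvd_prod_of_mem _ (Finset.mem_univ i))
  calc ∑ b ∈ B, Real.log (x / Nm b) ^ r / (r.factorial : ℝ)
      = ∑ b ∈ B, F ⟨Fin.tail (g b), g b 0⟩ := by
        apply Finset.sum_congr rfl
        intro b hb
        simp only [hF]
        rw [← hprod b hb, Fin.prod_univ_succ, div_div]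
        push_cast
        simp only [Fin.tail]
        rw [mul_comm]
    _ = ∑ p ∈ B.image (fun b => (⟨Fin.tail (g b), g b 0⟩ : Σ _ : Fin k → ℕ, ℕ)), F p := by
        rw [Finset.sum_image]
        intro b hb b' hb' h
        apply inj hb hb'
        simp only [Sigma.mk.injEq] at h
        rw [← Fin.cons_self_tail (g b), ← Fin.cons_self_tail (g b'), h.1, eq_of_heq h.2]
    _ ≤ ∑ p ∈ T, F p := by
        apply Finset.sum_le_sum_of_subset_of_nonneg
        · intro p hp
          obtain ⟨b, hb, rfl⟩ := Finset.mem_image.1 hp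
          rw [hT, Finset.mem_sigma]
          have hm : Fin.tail (g b) ∈ P := by
            rw [hP, Fintype.mem_piFinset]
            intro i
            exact Finset.mem_Icc.2 ⟨hentry b hb _, hentry2 b hb _⟩
          refine ⟨hm, Finset.mem_Icc.2 ⟨hentry b hb 0, Nat.le_floor ?_⟩⟩
          have := hPpos _ hm
          rw [le_div_iff₀ (by exact_mod_cast this)]
          refine le_trans (le_of_eq ?_) (hx b hb)
          rw [← hprod b hb, Fin.prod_univ_succ]
          push_cast
          rfl
        · intro p hp _
          rw [hT, Finset.mem_sigma, Finset.mem_Icc] at hp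
          have h1 := hPpos _ hp.1
          have h2 : (p.2 : ℝ) ≤ x / ((∏ i, p.1 i : ℕ) : ℝ) :=
            (Nat.le_floor_iff (by positivity)).1 hp.2.2
          have h3 : (1 : ℝ) ≤ p.2 := by exact_mod_cast hp.2.1
          have : 0 ≤ Real.log (x / ((∏ i, p.1 i : ℕ) : ℝ) / p.2) :=
            Real.log_nonneg (by rw [le_div_iff₀ (by linarith)]; linarith)
          simp only [hF]
          positivity
    _ = ∑ m ∈ P, ∑ a ∈ Finset.Icc 1 ⌊x / ((∏ i, m i : ℕ) : ℝ)⌋₊,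
          Real.log (x / ((∏ i, m i : ℕ) : ℝ) / a) ^ r / (r.factorial : ℝ) := by
        rw [hT, Finset.sum_sigma]
    _ ≤ ∑ m ∈ P, x / ((∏ i, m i : ℕ) : ℝ) * min 1 (Real.log x) ^ r := by
        apply Finset.sum_le_sum
        intro m hm
        have h1 : (1 : ℝ) ≤ ((∏ i, m i : ℕ) : ℝ) := by exact_mod_cast hPpos m hm
        exact lou_sum_log r (by positivity) (div_le_self (by linarith) h1) hx1 _
          (Nat.floor_le (by positivity))
    _ = x * (∑ m ∈ P, ∏ i, ((m i : ℝ))⁻¹) * min 1 (Real.log x) ^ r := by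
        rw [← Finset.sum_mul, Finset.mul_sum]
        congr 1
        apply Finset.sum_congr rfl
        intro m _
        rw [Finset.prod_inv_distrib]
        push_cast
        rfl
    _ ≤ _ := by
        have h1 : ∑ m ∈ P, ∏ i, ((m i : ℝ))⁻¹ = (∑ a ∈ Finset.Icc 1 N, ((a : ℝ))⁻¹) ^ k := by
          rw [hP, ← Finset.prod_univ_sum (fun _ : Fin k => Finset.Icc 1 N)
            (fun _ a => ((a : ℝ))⁻¹)]
          simp
        have h2 : ∑ a ∈ Finset.Icc 1 N, ((a : ℝ))⁻¹ ≤ 1 + Real.log x := by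
          have := harmonic_floor_le_one_add_log x hx1
          rw [harmonic_eq_sum_Icc] at this
          push_cast at this
          exact this
        rw [h1]
        have : 0 ≤ ∑ a ∈ Finset.Icc 1 N, ((a : ℝ))⁻¹ := Finset.sum_nonneg (fun i _ => by positivity)
        gcongr
section LouSimplex
open MeasureTheory
lemma lou_simplex_fin (n : ℕ) (L : ℝ) (hL : 0 ≤ L) :
    volume {y : Fin n → ℝ | (∀ i, 0 ≤ y i) ∧ ∑ i, y i ≤ L} ≤
      ENNReal.ofReal (L ^ n / (n.factorial : ℝ)) := by
  induction n generalizing L with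
  | zero =>
    refine (measure_mono (Set.subset_univ _)).trans ?_
    rw [volume_pi]
    simp
  | succ n ih =>
    set S : Set (ℝ × (Fin n → ℝ)) :=
      {p | 0 ≤ p.1 ∧ (∀ i, 0 ≤ p.2 i) ∧ p.1 + ∑ i, p.2 i ≤ L} with hS
    have hSm : MeasurableSet S := by
      apply IsClosed.measurableSet
      have : S = {p | 0 ≤ p.1} ∩ ((⋂ i, {p | 0 ≤ p.2 i}) ∩ {p | p.1 + ∑ i, p.2 i ≤ L}) := by
        ext p; simp [hS]
      rw [this]
      refine (isClosed_le (by fun_prop) (by fun_prop)).inter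
        ((isClosed_iInter fun i => isClosed_le (by fun_prop) (by fun_prop)).inter
          (isClosed_le (by fun_prop) (by fun_prop)))
    have hmp := volume_preserving_piFinSuccAbove (fun _ : Fin (n + 1) => ℝ) 0
    have hpre : {y : Fin (n + 1) → ℝ | (∀ i, 0 ≤ y i) ∧ ∑ i, y i ≤ L} =
        (MeasurableEquiv.piFinSuccAbove (fun _ : Fin (n + 1) => ℝ) 0) ⁻¹' S := by
      ext y
      simp [hS, Fin.forall_fin_succ, Fin.sum_univ_succ, MeasurableEquiv.piFinSuccAbove, and_assoc,
        Fin.tail]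
    rw [hpre, hmp.measure_preimage hSm.nullMeasurableSet, Measure.volume_eq_prod,
      Measure.prod_apply hSm]
    calc _ ≤ ∫⁻ t in Set.Icc 0 L, ENNReal.ofReal ((L - t) ^ n / (n.factorial : ℝ)) := by
          rw [← lintegral_indicator measurableSet_Icc]
          apply lintegral_mono
          intro t
          by_cases ht : t ∈ Set.Icc 0 L
          · rw [Set.indicator_of_mem ht]
            refine le_trans (measure_mono ?_) (ih (L - t) (by linarith [ht.2]))
            intro y hy
            simp only [hS, Set.mem_preimage, Set.mem_ofPred_eq] at hy ⊢
            exact ⟨hy.2.1, by linarith [hy.2.2]⟩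
          · have : Prod.mk t ⁻¹' S = ∅ := by
              rw [Set.eq_empty_iff_forall_notMem]
              intro y hy
              simp only [hS, Set.mem_preimage, Set.mem_ofPred_eq] at hy
              exact ht ⟨hy.1, by linarith [hy.2.2, Finset.sum_nonneg fun i (_ : i ∈ Finset.univ) => hy.2.1 i]⟩
            simp only [this, measure_empty]
            exact zero_le
      _ = ENNReal.ofReal (∫ t in Set.Icc 0 L, ((L - t) ^ n / (n.factorial : ℝ))) := by
          rw [ofReal_integral_eq_lintegral_ofReal]
          · exact (Continuous.integrableOn_Icc (by fun_prop))
          · rw [Filter.EventuallyLE, ae_restrict_iff' measurableSet_Icc]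
            refine Filter.Eventually.of_forall fun t ht => ?_
            have : 0 ≤ L - t := by linarith [ht.2]
            simp only [Pi.zero_apply]
            positivity
      _ ≤ _ := by
          apply ENNReal.ofReal_le_ofReal
          rw [integral_Icc_eq_integral_Ioc, ← intervalIntegral.integral_of_le hL,
            intervalIntegral.integral_div,
            intervalIntegral.integral_comp_sub_left (fun t => t ^ n) L]
          simp only [sub_self, sub_zero, integral_pow]
          rw [Nat.factorial_succ]
          push_cast
          rw [div_div]
          simp

lemma lou_simplex {ι : Type*} [Fintype ι] (L : ℝ) (hL : 0 ≤ L) :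
    volume {y : ι → ℝ | (∀ i, 0 ≤ y i) ∧ ∑ i, y i ≤ L} ≤
      ENNReal.ofReal (L ^ (Fintype.card ι) / ((Fintype.card ι).factorial : ℝ)) := by
  have e := Fintype.equivFin ι
  have hmp := volume_measurePreserving_piCongrLeft (fun _ : ι => ℝ) e.symm
  have := hmp.measure_preimage_equiv {y : ι → ℝ | (∀ i, 0 ≤ y i) ∧ ∑ i, y i ≤ L}
  rw [← this]
  refine le_trans (le_of_eq ?_) (lou_simplex_fin _ L hL)
  congr 1
  ext y
  simp only [Set.mem_preimage, Set.mem_ofPred_eq]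
  have h : ∀ j, (MeasurableEquiv.piCongrLeft (fun _ : ι => ℝ) e.symm) y j = y (e j) := by
    intro j
    have := MeasurableEquiv.piCongrLeft_apply_apply (β := fun _ : ι => ℝ) e.symm y (e j)
    simpa using this
  simp only [h]
  rw [e.sum_comp y]
  refine and_congr_left fun _ => ⟨fun h i => by simpa using h (e.symm i), fun h i => h _⟩

end LouSimplex

section LouIdeals
variable {K : Type*} [Field K] [NumberField K]

lemma lou_absNorm_of_mem {P : Ideal (𝓞 K)} (hP : P.IsPrime) {p : ℕ}
    (hp : p.Prime) (hpP : (p : 𝓞 K) ∈ P) :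
    ∃ f, 0 < f ∧ Ideal.absNorm P = p ^ f ∧ f ≤ Module.finrank ℚ K := by
  have h1 : Ideal.absNorm P ∣ p ^ Module.finrank ℚ K := by
    have := Ideal.absNorm_dvd_absNorm_of_le ((Ideal.span_singleton_le_iff_mem P).2 hpP)
    rw [Ideal.absNorm_span_singleton] at this
    have h2 := Algebra.norm_algebraMap_of_basis (RingOfIntegers.basis K) (p : ℤ)
    rw [← Module.finrank_eq_card_basis (RingOfIntegers.basis K), RingOfIntegers.rank] at h2
    simp only [algebraMap_int_eq, eq_intCast, Int.cast_natCast] at h2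
    rw [h2] at this
    simpa [Int.natAbs_pow] using this
  obtain ⟨f, hf, hf'⟩ := (Nat.dvd_prime_pow hp).1 h1
  refine ⟨f, Nat.pos_of_ne_zero ?_, hf', hf⟩
  rintro rfl
  rw [pow_zero, Ideal.absNorm_eq_one_iff] at hf'
  exact hP.ne_top hf'

lemma lou_exists_prime_mem {P : Ideal (𝓞 K)} (hP : P.IsPrime) (h0 : P ≠ ⊥) :
    ∃ p : ℕ, p.Prime ∧ (p : 𝓞 K) ∈ P := by
  have hN : Ideal.absNorm P ≠ 0 := by rwa [Ne, Ideal.absNorm_eq_zero_iff]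
  have hmem : ((Ideal.absNorm P : ℕ) : 𝓞 K) ∈ P := Ideal.absNorm_mem P
  rw [← Nat.prod_primeFactorsList hN] at hmem
  push_cast at hmem
  generalize hl : (Ideal.absNorm P).primeFactorsList = l at hmem
  have hpr : ∀ q ∈ l, q.Prime := by
    intro q hq
    rw [← hl] at hq
    exact Nat.prime_of_mem_primeFactorsList hq
  clear hl
  induction l with
  | nil =>
    simp at hmem
    exact absurd ((Ideal.eq_top_iff_one P).2 hmem) hP.ne_top
  | cons q l ih =>
    simp only [List.map_cons, List.prod_cons] at hmem
    rcases hP.mem_or_mem hmem with h | h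
    · exact ⟨q, hpr q (by simp), h⟩
    · exact ih h (fun q' hq' => hpr q' (by simp [hq']))

/-- the rational prime below a prime ideal -/
noncomputable def louPr (P : Ideal (𝓞 K)) : ℕ := (Ideal.absNorm P).minFac

lemma louPr_spec {P : Ideal (𝓞 K)} (hP : P.IsPrime) (h0 : P ≠ ⊥) :
    (louPr P).Prime ∧ (louPr P : 𝓞 K) ∈ P ∧ ∃ f, 0 < f ∧ Ideal.absNorm P = louPr P ^ f := by
  obtain ⟨p, hp, hpP⟩ := lou_exists_prime_mem hP h0
  obtain ⟨f, hf, hfP, -⟩ := lou_absNorm_of_mem hP hp hpP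
  have : louPr P = p := by rw [louPr, hfP, hp.pow_minFac hf.ne']
  rw [this]
  exact ⟨hp, hpP, f, hf, hfP⟩

lemma lou_card_primes (p : ℕ) (hp : p.Prime) (S : Finset (Ideal (𝓞 K)))
    (hS : ∀ P ∈ S, P.IsPrime ∧ P ≠ ⊥ ∧ (p : 𝓞 K) ∈ P) : S.card ≤ Module.finrank ℚ K := by
  have h1 : (∏ P ∈ S, P) ∣ Ideal.span {(p : 𝓞 K)} := by
    apply Finset.prod_primes_dvd
    · intro P hP
      exact Ideal.prime_of_isPrime (hS P hP).2.1 (hS P hP).1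
    · intro P hP
      rw [Ideal.dvd_iff_le, Ideal.span_singleton_le_iff_mem]
      exact (hS P hP).2.2
  have h2 := map_dvd Ideal.absNorm h1
  rw [Ideal.absNorm_span_singleton] at h2
  have h3 := Algebra.norm_algebraMap_of_basis (RingOfIntegers.basis K) (p : ℤ)
  rw [← Module.finrank_eq_card_basis (RingOfIntegers.basis K), RingOfIntegers.rank] at h3
  simp only [algebraMap_int_eq, eq_intCast, Int.cast_natCast] at h3
  rw [h3, map_prod] at h2
  simp only [Int.natAbs_pow, Int.natAbs_natCast] at h2
  have h4 : p ^ S.card ∣ ∏ P ∈ S, Ideal.absNorm P := by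
    rw [← Finset.prod_const]
    apply Finset.prod_dvd_prod_of_dvd
    intro P hP
    obtain ⟨f, hf, hfP, -⟩ := lou_absNorm_of_mem (hS P hP).1 hp (hS P hP).2.2
    rw [hfP]
    exact dvd_pow_self p hf.ne'
  exact (Nat.pow_dvd_pow_iff_le_right hp.one_lt).1 (h4.trans h2)

lemma lou_exists_label (p : ℕ) : ∃ c : Ideal (𝓞 K) → Fin (Module.finrank ℚ K),
    p.Prime → Set.InjOn c {P | P.IsPrime ∧ P ≠ ⊥ ∧ (p : 𝓞 K) ∈ P} := by
  classical
  have hpos : 0 < Module.finrank ℚ K := Module.finrank_pos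
  by_cases hp : p.Prime
  swap
  · exact ⟨fun _ => ⟨0, hpos⟩, fun h => absurd h hp⟩
  have hp0 : Ideal.span {(p : 𝓞 K)} ≠ 0 := by
    simp [hp.ne_zero]
  set S := (UniqueFactorizationMonoid.normalizedFactors (Ideal.span {(p : 𝓞 K)})).toFinset
  have hS : ∀ P, P ∈ S ↔ P.IsPrime ∧ P ≠ ⊥ ∧ (p : 𝓞 K) ∈ P := by
    intro P
    simp only [S, Multiset.mem_toFinset]
    rw [Ideal.mem_normalizedFactors_iff hp0, Ideal.span_singleton_le_iff_mem]
    constructor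
    · rintro ⟨h1, h2⟩
      refine ⟨h1, ?_, h2⟩
      rintro rfl
      simp [hp.ne_zero] at h2
    · exact fun h => ⟨h.1, h.2.2⟩
  have hcard := lou_card_primes p hp S (fun P hP => (hS P).1 hP)
  refine ⟨fun P => if h : P ∈ S then Fin.castLE hcard (S.equivFin ⟨P, h⟩) else ⟨0, hpos⟩,
    fun _ P hP Q hQ h => ?_⟩
  have h1 := (hS P).2 hP
  have h2 := (hS Q).2 hQ
  simp only [h1, h2, dite_true] at h
  have := S.equivFin.injective (Fin.castLE_injective hcard h)
  simpa using this

lemma lou_prod_filter {α ι : Type*} [Fintype ι] [DecidableEq ι] (s : Multiset α) (h : α → ι)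
    (f : α → ℕ) : ∏ i, ((s.filter (fun a => h a = i)).map f).prod = (s.map f).prod := by
  induction s using Multiset.induction with
  | empty => simp
  | cons a s ih =>
    rw [Multiset.map_cons, Multiset.prod_cons, ← ih]
    have : ∀ i, (((a ::ₘ s).filter (fun a => h a = i)).map f).prod =
        (if h a = i then f a else 1) * ((s.filter (fun a => h a = i)).map f).prod := by
      intro i
      rw [Multiset.filter_cons]
      split_ifs <;> simp
    simp only [this, Finset.prod_mul_distrib, Finset.prod_ite_eq, Finset.mem_univ, if_true]

lemma lou_count {n : ℕ} (c : ℕ → Ideal (𝓞 K) → Fin n)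
    (hc : ∀ p : ℕ, p.Prime → Set.InjOn (c p) {P | P.IsPrime ∧ P ≠ ⊥ ∧ (p : 𝓞 K) ∈ P})
    [DecidableEq (Ideal (𝓞 K))]
    {P : Ideal (𝓞 K)} (hP : P.IsPrime) (h0 : P ≠ ⊥) (s : Multiset (Ideal (𝓞 K)))
    (hs : ∀ Q ∈ s, Q.IsPrime ∧ Q ≠ ⊥) :
    (((s.filter (fun Q => c (louPr Q) Q = c (louPr P) P)).map Ideal.absNorm).prod).factorization
      (louPr P) = s.count P * (Ideal.absNorm P).factorization (louPr P) ∧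
    ((s.filter (fun Q => c (louPr Q) Q = c (louPr P) P)).map Ideal.absNorm).prod ≠ 0 := by
  induction s using Multiset.induction with
  | empty => simp
  | cons Q s ih =>
    obtain ⟨ih1, ih2⟩ := ih (fun Q' hQ' => hs Q' (by simp [hQ']))
    obtain ⟨hQ, hQ0⟩ := hs Q (by simp)
    have hN : Ideal.absNorm Q ≠ 0 := by rwa [Ne, Ideal.absNorm_eq_zero_iff]
    rw [Multiset.filter_cons, Multiset.count_cons]
    obtain ⟨hpP, hpP', fP, hfP, hfP'⟩ := louPr_spec hP h0
    obtain ⟨hpQ, hpQ', fQ, hfQ, hfQ'⟩ := louPr_spec hQ hQ0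
    by_cases h : c (louPr Q) Q = c (louPr P) P
    · simp only [h, if_true, Multiset.map_add, Multiset.prod_add, Multiset.map_singleton,
        Multiset.prod_singleton]
      refine ⟨?_, mul_ne_zero hN ih2⟩
      rw [Nat.factorization_mul hN ih2, Finsupp.add_apply, ih1]
      by_cases hPQ : P = Q
      · subst hPQ
        simp
        ring
      · simp only [hPQ, if_false, add_zero]
        have hne : louPr Q ≠ louPr P := by
          intro he
          rw [he] at h hpQ'
          exact hPQ (hc _ hpP ⟨hQ, hQ0, hpQ'⟩ ⟨hP, h0, hpP'⟩ h).symm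
        rw [hfQ', hpQ.factorization_pow, Finsupp.single_apply, if_neg hne, zero_add]
    · have hPQ : P ≠ Q := by rintro rfl; exact h rfl
      simp only [h, if_false, hPQ, add_zero, zero_add]
      exact ⟨ih1, ih2⟩

variable (K) in
lemma lou_ideal_tuple : ∃ g : Ideal (𝓞 K) → Fin (Module.finrank ℚ K) → ℕ,
    Set.InjOn g {b | b ≠ ⊥} ∧ ∀ b, b ≠ ⊥ → ∏ i, g b i = Ideal.absNorm b := by
  classical
  choose c hc using fun p : ℕ => lou_exists_label (K := K) p
  refine ⟨fun b i => (((UniqueFactorizationMonoid.normalizedFactors b).filter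
    (fun Q => c (louPr Q) Q = i)).map Ideal.absNorm).prod, ?_, ?_⟩
  · intro b hb b' hb' h
    have hf : ∀ a : Ideal (𝓞 K), a ≠ ⊥ → ∀ Q ∈ UniqueFactorizationMonoid.normalizedFactors a,
        Q.IsPrime ∧ Q ≠ ⊥ := by
      intro a ha Q hQ
      have := UniqueFactorizationMonoid.prime_of_normalized_factor Q hQ
      exact ⟨Ideal.isPrime_of_prime this, this.ne_zero⟩
    have key : UniqueFactorizationMonoid.normalizedFactors b =
        UniqueFactorizationMonoid.normalizedFactors b' := by
      ext P
      by_cases hP : P.IsPrime ∧ P ≠ ⊥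
      · have h1 := (lou_count c hc hP.1 hP.2 _ (hf b hb)).1
        have h2 := (lou_count c hc hP.1 hP.2 _ (hf b' hb')).1
        have h3 := congrFun h (c (louPr P) P)
        simp only at h3
        rw [h3, h2] at h1
        obtain ⟨hpP, hpP', fP, hfP, hfP'⟩ := louPr_spec hP.1 hP.2
        have h4 : (Ideal.absNorm P).factorization (louPr P) = fP := by
          rw [hfP', hpP.factorization_pow, Finsupp.single_eq_same]
        rw [h4] at h1
        exact (Nat.eq_of_mul_eq_mul_right hfP h1).symm
      · rw [Multiset.count_eq_zero.2 fun h => hP (hf b hb P h),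
          Multiset.count_eq_zero.2 fun h => hP (hf b' hb' P h)]
    have h1 := Ideal.prod_normalizedFactors_eq_self hb
    have h2 := Ideal.prod_normalizedFactors_eq_self hb'
    rw [← h1, key, h2]
  · intro b hb
    rw [lou_prod_filter]
    conv_rhs => rw [← Ideal.prod_normalizedFactors_eq_self hb]
    rw [map_multiset_prod]

end LouIdeals

section LouCover
open NumberField.InfinitePlace NumberField.mixedEmbedding MeasureTheory nonZeroDivisors
variable (K : Type*) [Field K] [NumberField K]

/-- the Minkowski constant `(2/π)^s √|Δ|` -/
noncomputable def louD : ℝ :=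
  (2 / Real.pi) ^ nrComplexPlaces K * Real.sqrt (|NumberField.discr K| : ℝ)

lemma lou_minkowski (J : (Ideal (𝓞 K))⁰) (u : InfinitePlace K → ℝ) {d' : ℝ} (hd : louD K < d')
    (hu : ∑ w, u w = Real.log (d' * Ideal.absNorm (J : Ideal (𝓞 K)))) :
    ∃ a : 𝓞 K, a ∈ (J : Ideal (𝓞 K)) ∧ a ≠ 0 ∧ ∀ w : InfinitePlace K,
      (mult w : ℝ) * Real.log (w (a : K)) ≤ u w := by
  classical
  have hd0 : 0 ≤ louD K := by unfold louD; positivity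
  have hJ0 : (J : Ideal (𝓞 K)) ≠ ⊥ := mem_nonZeroDivisors_iff_ne_zero.1 J.2
  have hNJ : 0 < Ideal.absNorm (J : Ideal (𝓞 K)) :=
    Nat.pos_of_ne_zero (by rwa [Ne, Ideal.absNorm_eq_zero_iff])
  have hNJ' : (0 : ℝ) < Ideal.absNorm (J : Ideal (𝓞 K)) := by exact_mod_cast hNJ
  set f : InfinitePlace K → NNReal := fun w => Real.toNNReal (Real.exp (u w / mult w)) with hf
  have hmult : ∀ w : InfinitePlace K, (mult w : ℝ) ≠ 0 := fun w => by
    exact_mod_cast (mult_pos (w := w)).ne'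
  have hfprod : ((∏ w, (f w) ^ (mult w) : NNReal) : ℝ) =
      d' * Ideal.absNorm (J : Ideal (𝓞 K)) := by
    push_cast
    have : ∀ w, ((f w : ℝ)) ^ (mult w) = Real.exp (u w) := by
      intro w
      rw [hf, Real.coe_toNNReal _ (Real.exp_pos _).le, ← Real.exp_nat_mul]
      congr 1
      have := hmult w
      field_simp
    simp only [this]
    rw [← Real.exp_sum, hu, Real.exp_log (by have := hd0.trans_lt hd; positivity)]
  set I : (FractionalIdeal (𝓞 K)⁰ K)ˣ := Units.mk0 ((J : Ideal (𝓞 K)) : FractionalIdeal (𝓞 K)⁰ K)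
    (by rwa [Ne, FractionalIdeal.coeIdeal_eq_zero]) with hI
  have hlt : minkowskiBound K I < volume (convexBodyLT K f) := by
    rw [convexBodyLT_volume, minkowskiBound, volume_fundamentalDomain_fractionalIdealLatticeBasis,
      volume_fundamentalDomain_latticeBasis, mixedEmbedding.finrank]
    rw [← ENNReal.toReal_lt_toReal]
    rotate_left
    · finiteness
    · finiteness
    simp only [ENNReal.toReal_mul, ENNReal.toReal_pow, ENNReal.toReal_inv, ENNReal.toReal_ofNat,
      ENNReal.coe_toReal]
    have h1 : (FractionalIdeal.absNorm (I : FractionalIdeal (𝓞 K)⁰ K) : ℝ) =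
        Ideal.absNorm (J : Ideal (𝓞 K)) := by
      rw [hI, Units.val_mk0, FractionalIdeal.coeIdeal_absNorm]
      simp
    rw [h1, ENNReal.toReal_ofReal hNJ'.le]
    have h2 : (∏ w, ((f w : ENNReal)) ^ (mult w)).toReal =
        d' * Ideal.absNorm (J : Ideal (𝓞 K)) := by
      rw [← hfprod]
      norm_cast
    simp only [NNReal.coe_mul, NNReal.coe_pow, NNReal.coe_ofNat, NNReal.coe_real_pi, Real.coe_sqrt,
      coe_nnnorm, Int.norm_eq_abs]
    rw [hfprod]
    rw [← card_add_two_mul_card_eq_rank]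
    unfold louD at hd
    have h3 : (0 : ℝ) < 2 ^ nrRealPlaces K * Real.pi ^ nrComplexPlaces K *
      Ideal.absNorm (J : Ideal (𝓞 K)) := by positivity
    have h4 := mul_lt_mul_of_pos_left hd h3
    refine lt_of_eq_of_lt ?_ (h4.trans_eq (by ring))
    rw [div_pow, pow_add, pow_mul, inv_pow]
    have : (2 : ℝ) ^ 2 = 2 * 2 := by norm_num
    rw [this, mul_pow]
    field_simp
    try push_cast
    try ring
  obtain ⟨a, ha, ha0, haw⟩ := exists_ne_zero_mem_ideal_lt K I hlt
  rw [hI, Units.val_mk0, FractionalIdeal.mem_coeIdeal] at ha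
  obtain ⟨a', ha', rfl⟩ := ha
  refine ⟨a', ha', ?_, ?_⟩
  · rintro rfl
    simp at ha0
  · intro w
    have h1 := haw w
    rw [hf, Real.coe_toNNReal _ (Real.exp_pos _).le] at h1
    have h2 := (Real.log_lt_iff_lt_exp (pos_iff.2 ha0)).2 h1
    have h3 : (0 : ℝ) < mult w := by exact_mod_cast mult_pos
    rw [lt_div_iff₀ h3] at h2
    rw [mul_comm]
    exact h2.le

end LouCover

section LouCover2
open NumberField.InfinitePlace NumberField.mixedEmbedding MeasureTheory nonZeroDivisors
open NumberField.Units NumberField.Units.dirichletUnitTheorem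
variable (K : Type*) [Field K] [NumberField K]
open scoped Pointwise

open scoped Classical in
lemma lou_unfold {β : Type*} (B : Finset β) (T : β → Set (logSpace K))
    (hT : ∀ y : logSpace K, ∃ b ∈ B, ∃ l ∈ unitLattice K, y - l ∈ T b) :
    ENNReal.ofReal (regulator K) ≤ ∑ b ∈ B, volume (T b) := by
  have hfd := ZLattice.isAddFundamentalDomain (basisUnitLattice K) (volume : Measure (logSpace K))
  set F := ZSpan.fundamentalDomain ((basisUnitLattice K).ofZLatticeBasis ℝ (unitLattice K))
  have i1 : MeasurableVAdd (unitLattice K) (logSpace K) :=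
    (inferInstance : MeasurableVAdd (unitLattice K).toAddSubgroup (logSpace K))
  have i2 : VAddInvariantMeasure (unitLattice K) (logSpace K) volume :=
    (inferInstance : VAddInvariantMeasure (unitLattice K).toAddSubgroup (logSpace K) volume)
  have hreg : ENNReal.ofReal (regulator K) = volume F := by
    rw [regulator, ZLattice.covolume_eq_measure_fundamentalDomain _ _ hfd]
    apply ENNReal.ofReal_toReal
    exact (ZSpan.fundamentalDomain_isBounded _).measure_lt_top.ne
  rw [hreg]
  calc volume F ≤ volume (⋃ b ∈ B, ⋃ l : unitLattice K, (l +ᵥ T b) ∩ F) := by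
        apply measure_mono
        intro y hy
        obtain ⟨b, hb, l, hl, h⟩ := hT y
        simp only [Set.mem_iUnion]
        refine ⟨b, hb, ⟨l, hl⟩, ?_, hy⟩
        refine ⟨y - l, h, ?_⟩
        change l + (y - l) = y
        simp
    _ ≤ ∑ b ∈ B, volume (⋃ l : unitLattice K, (l +ᵥ T b) ∩ F) := measure_biUnion_finset_le _ _
    _ ≤ ∑ b ∈ B, volume (T b) := by
        apply Finset.sum_le_sum
        intro b _
        rw [hfd.measure_eq_tsum (T b)]
        exact measure_iUnion_le _

end LouCover2
section LouCover3
open NumberField.InfinitePlace NumberField.mixedEmbedding MeasureTheory nonZeroDivisors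
open NumberField.Units NumberField.Units.dirichletUnitTheorem
variable (K : Type*) [Field K] [NumberField K]

variable {K} in
lemma lou_sum_log_norm {J b : Ideal (𝓞 K)} {a : 𝓞 K} (h : Ideal.span {a} = b * J)
    (ha : a ≠ 0) :
    ∑ w : InfinitePlace K, (mult w : ℝ) * Real.log (w (a : K)) =
      Real.log ((Ideal.absNorm b : ℝ) * Ideal.absNorm J) := by
  have h1 : ∏ w : InfinitePlace K, w (a : K) ^ mult w = (Ideal.absNorm b : ℝ) * Ideal.absNorm J := by
    rw [prod_eq_abs_norm]
    have h2 := congrArg Ideal.absNorm h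
    rw [Ideal.absNorm_span_singleton, map_mul] at h2
    rw [← Algebra.coe_norm_int]
    have h3 : (((Algebra.norm ℤ a).natAbs : ℕ) : ℝ) =
      (Ideal.absNorm b : ℝ) * Ideal.absNorm J := by exact_mod_cast h2
    rw [← h3, Nat.cast_natAbs]
    push_cast
    rfl
  rw [← h1, Real.log_prod]
  · simp
  · intro w _
    apply pow_ne_zero
    rw [map_ne_zero]
    exact_mod_cast ha

lemma lou_class (J : (Ideal (𝓞 K))⁰) {d' : ℝ} (hd : louD K < d')
    (B : Finset (Ideal (𝓞 K))⁰)
    (hB : ∀ b : (Ideal (𝓞 K))⁰, b ∈ B ↔ (Ideal.absNorm (b : Ideal (𝓞 K)) : ℝ) ≤ d' ∧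
      ClassGroup.mk0 b * ClassGroup.mk0 J = 1) :
    regulator K ≤ ∑ b ∈ B, Real.log (d' / Ideal.absNorm (b : Ideal (𝓞 K))) ^ (rank K) /
      ((rank K).factorial : ℝ) := by
  classical
  have hd0 : 0 ≤ louD K := by unfold louD; positivity
  have hd' : 0 < d' := hd0.trans_lt hd
  have hpos : ∀ b : (Ideal (𝓞 K))⁰, (0 : ℝ) < Ideal.absNorm (b : Ideal (𝓞 K)) := by
    intro b
    have : (b : Ideal (𝓞 K)) ≠ ⊥ := mem_nonZeroDivisors_iff_ne_zero.1 b.2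
    exact_mod_cast Nat.pos_of_ne_zero (by rwa [Ne, Ideal.absNorm_eq_zero_iff])
  have hex : ∀ b : (Ideal (𝓞 K))⁰, ∃ a : 𝓞 K, ClassGroup.mk0 b * ClassGroup.mk0 J = 1 →
      a ≠ 0 ∧ Ideal.span {a} = (b : Ideal (𝓞 K)) * J := by
    intro b
    by_cases h : ClassGroup.mk0 b * ClassGroup.mk0 J = 1
    · rw [← map_mul, ClassGroup.mk0_eq_one_iff (b * J).2] at h
      obtain ⟨a, ha⟩ := h
      have ha' : Ideal.span {a} = (b : Ideal (𝓞 K)) * J := ha.symm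
      refine ⟨a, fun _ => ⟨?_, ha'⟩⟩
      rintro rfl
      have := mem_nonZeroDivisors_iff_ne_zero.1 (b * J).2
      apply this
      rw [Submonoid.coe_mul, ← ha']
      simp
    · exact ⟨0, fun h' => absurd h' h⟩
  choose α hα using hex
  have hcard : Fintype.card {w : InfinitePlace K // w ≠ w₀} = rank K := by
    rw [Fintype.card_subtype_compl, Fintype.card_subtype_eq, rank]
  set T : (Ideal (𝓞 K))⁰ → Set (logSpace K) := fun b =>
    {y | (∀ w : {w : InfinitePlace K // w ≠ w₀}, (mult w.1 : ℝ) * Real.log (w.1 (α b : K)) ≤ y w) ∧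
      (mult (w₀ : InfinitePlace K) : ℝ) * Real.log (w₀ (α b : K)) + ∑ w, y w ≤
        Real.log (d' * Ideal.absNorm (J : Ideal (𝓞 K)))} with hTdef
  have hsplit : ∀ u : InfinitePlace K → ℝ,
      ∑ w, u w = u w₀ + ∑ w : {w : InfinitePlace K // w ≠ w₀}, u w.1 := fun u =>
    Fintype.sum_eq_add_sum_subtype_ne u w₀
  have hcover : ∀ y : logSpace K, ∃ b ∈ B, ∃ l ∈ unitLattice K, y - l ∈ T b := by
    intro y
    set u : InfinitePlace K → ℝ := fun w => if h : w ≠ w₀ then y ⟨w, h⟩ else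
      Real.log (d' * Ideal.absNorm (J : Ideal (𝓞 K))) - ∑ w, y w with hu
    have hu1 : ∀ w : {w : InfinitePlace K // w ≠ w₀}, u w.1 = y w := by
      intro w
      simp [hu, w.2]
    have hu0 : u w₀ = Real.log (d' * Ideal.absNorm (J : Ideal (𝓞 K))) - ∑ w, y w := by
      simp [hu]
    have husum : ∑ w, u w = Real.log (d' * Ideal.absNorm (J : Ideal (𝓞 K))) := by
      rw [hsplit, hu0]
      simp only [hu1]
      ring
    obtain ⟨a, haJ, ha0, haw⟩ := lou_minkowski K J u hd husum
    obtain ⟨b, hb⟩ := Ideal.dvd_iff_le.2 ((Ideal.span_singleton_le_iff_mem _).2 haJ)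
    have hb0 : b ∈ (Ideal (𝓞 K))⁰ := by
      rw [mem_nonZeroDivisors_iff_ne_zero]
      rintro rfl
      rw [mul_zero] at hb
      have : Ideal.span {a} = ⊥ := hb
      rw [Ideal.span_singleton_eq_bot] at this
      exact ha0 this
    rw [mul_comm] at hb
    have hcl : ClassGroup.mk0 (⟨b, hb0⟩ : (Ideal (𝓞 K))⁰) * ClassGroup.mk0 J = 1 := by
      rw [← map_mul, ClassGroup.mk0_eq_one_iff (⟨b, hb0⟩ * J : (Ideal (𝓞 K))⁰).2]
      exact ⟨a, hb.symm⟩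
    have hN : (Ideal.absNorm b : ℝ) ≤ d' := by
      have h1 := Finset.sum_le_sum (fun w (_ : w ∈ Finset.univ) => haw w)
      rw [husum, lou_sum_log_norm hb ha0] at h1
      have hbp := hpos ⟨b, hb0⟩
      simp only at hbp
      have hJp := hpos J
      rw [Real.log_le_log_iff (by positivity) (by positivity)] at h1
      exact le_of_mul_le_mul_right h1 hJp
    refine ⟨⟨b, hb0⟩, (hB _).2 ⟨hN, hcl⟩, ?_⟩
    obtain ⟨hα0, hα1⟩ := hα ⟨b, hb0⟩ hcl
    have hassoc : Associated (α ⟨b, hb0⟩) a := by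
      rw [← Ideal.span_singleton_eq_span_singleton, hα1, hb]
    obtain ⟨v, hv⟩ := hassoc
    refine ⟨logEmbedding K (Additive.ofMul v), ⟨Additive.ofMul v, trivial, rfl⟩, ?_⟩
    have hlog : ∀ w : InfinitePlace K, (mult w : ℝ) * Real.log (w (a : K)) =
        mult w * Real.log (w (α ⟨b, hb0⟩ : K)) + mult w * Real.log (w ((v : 𝓞 K) : K)) := by
      intro w
      have hcm : ((α ⟨b, hb0⟩ * (v : 𝓞 K) : 𝓞 K) : K) =
          (α ⟨b, hb0⟩ : K) * ((v : 𝓞 K) : K) := by simp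
      rw [← hv, hcm, map_mul, Real.log_mul]
      · ring
      · rw [map_ne_zero]; exact_mod_cast hα0
      · rw [map_ne_zero]; exact_mod_cast v.ne_zero
    simp only [hTdef, Set.mem_ofPred_eq]
    constructor
    · intro w
      have h1 := haw w.1
      rw [hlog, hu1] at h1
      rw [Pi.sub_apply, logEmbedding_component]
      linarith
    · have h1 := haw w₀
      rw [hlog, hu0] at h1
      simp only [Pi.sub_apply]
      rw [Finset.sum_sub_distrib, sum_logEmbedding_component]
      linarith
  have hmain := lou_unfold K B T hcover
  have hvol : ∀ b ∈ B, volume (T b) ≤ ENNReal.ofReal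
      (Real.log (d' / Ideal.absNorm (b : Ideal (𝓞 K))) ^ (rank K) / ((rank K).factorial : ℝ)) := by
    intro b hb
    obtain ⟨hbN, hbcl⟩ := (hB b).1 hb
    obtain ⟨hα0, hα1⟩ := hα b hbcl
    have hbp := hpos b
    have hJp := hpos J
    have hL : 0 ≤ Real.log (d' / Ideal.absNorm (b : Ideal (𝓞 K))) :=
      Real.log_nonneg (by rwa [le_div_iff₀ hbp, one_mul])
    have hs := lou_sum_log_norm hα1 hα0
    rw [hsplit] at hs
    have h1 := lou_simplex (ι := {w : InfinitePlace K // w ≠ w₀}) _ hL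
    rw [hcard] at h1
    refine le_trans (le_of_eq ?_) h1
    set c : logSpace K := fun w => -((mult w.1 : ℝ) * Real.log (w.1 (α b : K))) with hc
    conv_rhs => rw [← measure_preimage_add volume c]
    congr 1
    ext y
    simp only [hTdef, hc, Set.mem_ofPred_eq, Set.mem_preimage, Pi.add_apply,
      Finset.sum_add_distrib, Finset.sum_neg_distrib]
    apply and_congr
    · refine forall_congr' fun w => ?_
      constructor <;> intro h <;> linarith
    · rw [Real.log_div hd'.ne' hbp.ne']
      rw [Real.log_mul hbp.ne' hJp.ne'] at hs
      rw [Real.log_mul hd'.ne' hJp.ne']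
      constructor <;> intro h <;> linarith
  have h2 := hmain.trans (Finset.sum_le_sum hvol)
  rw [← ENNReal.ofReal_sum_of_nonneg] at h2
  · rw [ENNReal.ofReal_le_ofReal_iff] at h2
    · exact h2
    · apply Finset.sum_nonneg
      intro b hb
      have : 0 ≤ Real.log (d' / Ideal.absNorm (b : Ideal (𝓞 K))) :=
        Real.log_nonneg (by rw [le_div_iff₀ (hpos b), one_mul]; exact ((hB b).1 hb).1)
      positivity
  · intro b hb
    have : 0 ≤ Real.log (d' / Ideal.absNorm (b : Ideal (𝓞 K))) :=
      Real.log_nonneg (by rw [le_div_iff₀ (hpos b), one_mul]; exact ((hB b).1 hb).1)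
    positivity

lemma lou_total {d' : ℝ} (hd : louD K < d') :
    1 ≤ d' ∧ (classNumber K : ℝ) * regulator K ≤
      d' * (1 + Real.log d') ^ (Module.finrank ℚ K - 1) * min 1 (Real.log d') ^ (rank K) := by
  classical
  have hd0 : 0 ≤ louD K := by unfold louD; positivity
  have hd' : 0 < d' := hd0.trans_lt hd
  have hfin : {b : (Ideal (𝓞 K))⁰ | (Ideal.absNorm (b : Ideal (𝓞 K)) : ℝ) ≤ d'}.Finite := by
    refine (Ideal.finite_setOfPred_absNorm_le₀ (S := 𝓞 K) ⌊d'⌋₊).subset ?_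
    intro b hb
    exact Nat.le_floor hb
  set A := hfin.toFinset with hA
  have hAmem : ∀ b, b ∈ A ↔ (Ideal.absNorm (b : Ideal (𝓞 K)) : ℝ) ≤ d' := by
    intro b; simp [hA]
  choose J hJ using (ClassGroup.mk0_surjective (R := 𝓞 K))
  have h1 : (classNumber K : ℝ) * regulator K ≤ ∑ b ∈ A,
      Real.log (d' / Ideal.absNorm (b : Ideal (𝓞 K))) ^ (rank K) / ((rank K).factorial : ℝ) := by
    rw [← Finset.sum_fiberwise A (fun b => (ClassGroup.mk0 b)⁻¹)]
    have : (classNumber K : ℝ) * regulator K = ∑ _C : ClassGroup (𝓞 K), regulator K := by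
      rw [Finset.sum_const, nsmul_eq_mul, Finset.card_univ, classNumber]
    rw [this]
    apply Finset.sum_le_sum
    intro C _
    apply lou_class K (J C) hd
    intro b
    rw [Finset.mem_filter, hAmem, hJ, inv_eq_iff_mul_eq_one]
  have hpos : ∀ b : (Ideal (𝓞 K))⁰, 0 < Ideal.absNorm (b : Ideal (𝓞 K)) := by
    intro b
    have : (b : Ideal (𝓞 K)) ≠ ⊥ := mem_nonZeroDivisors_iff_ne_zero.1 b.2
    exact Nat.pos_of_ne_zero (by rwa [Ne, Ideal.absNorm_eq_zero_iff])
  have hone : 1 ≤ d' := by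
    by_contra hlt
    have hAe : A = ∅ := by
      rw [Finset.eq_empty_iff_forall_notMem]
      intro b hb
      have h2 := (hAmem b).1 hb
      have h3 : (1 : ℝ) ≤ Ideal.absNorm (b : Ideal (𝓞 K)) := by exact_mod_cast hpos b
      linarith
    rw [hAe, Finset.sum_empty] at h1
    have h2 := regulator_pos K
    have h3 : (0 : ℝ) < classNumber K := by
      exact_mod_cast (Fintype.card_pos : 0 < Fintype.card (ClassGroup (𝓞 K)))
    have := mul_pos h3 h2
    linarith
  refine ⟨hone, h1.trans ?_⟩
  obtain ⟨k, hk⟩ : ∃ k, Module.finrank ℚ K = k + 1 :=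
    ⟨_, (Nat.succ_pred_eq_of_pos (Module.finrank_pos (R := ℚ) (M := K))).symm⟩
  have ht := lou_ideal_tuple K
  rw [hk] at ht
  obtain ⟨g, hg, hgp⟩ := ht
  rw [hk, Nat.add_sub_cancel]
  refine lou_tuple_sum A (fun b => Ideal.absNorm (b : Ideal (𝓞 K))) (fun b => g b) ?_ ?_
    (fun b _ => hpos b) d' hone (fun b hb => (hAmem b).1 hb) (rank K)
  · intro b _ b' _ h
    exact Subtype.ext (hg (mem_nonZeroDivisors_iff_ne_zero.1 b.2)
      (mem_nonZeroDivisors_iff_ne_zero.1 b'.2) h)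
  · intro b _
    exact hgp _ (mem_nonZeroDivisors_iff_ne_zero.1 b.2)

lemma lou_limit : 1 ≤ louD K ∧ (classNumber K : ℝ) * regulator K ≤
      louD K * (1 + Real.log (louD K)) ^ (Module.finrank ℚ K - 1) *
        min 1 (Real.log (louD K)) ^ (rank K) := by
  have h1 : 1 ≤ louD K := le_of_forall_gt_imp_ge_of_dense fun d' h => (lou_total K h).1
  refine ⟨h1, ?_⟩
  have hc : ContinuousAt (fun x : ℝ => x * (1 + Real.log x) ^ (Module.finrank ℚ K - 1) *
        min 1 (Real.log x) ^ (rank K)) (louD K) := by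
    have : ContinuousAt Real.log (louD K) := Real.continuousAt_log (by linarith)
    fun_prop
  have h2 : Filter.Tendsto _ (nhdsWithin (louD K) (Set.Ioi (louD K))) _ :=
    hc.tendsto.mono_left nhdsWithin_le_nhds
  exact ge_of_tendsto h2 (Filter.eventually_of_mem self_mem_nhdsWithin
    fun d' h => (lou_total K h).2)

end LouCover3

lemma lou_min_bound {l : ℝ} (h : 0 ≤ l) : (1 + l) * min 1 l ≤ 2 * l := by
  rcases le_total 1 l with h1 | h1
  · rw [min_eq_left h1]; linarith
  · rw [min_eq_right h1]; nlinarith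

/-- Louboutin: For a number field `L` of degree `d_L`, with class number
`h_L`, regulator `R_L` and discriminant `Δ_L`,
`h_L R_L ≤ |Δ_L|^{1/2} (log* |Δ_L|)^{d_L - 1}` where `log* x = max(1, log x)`. -/
theorem stmt_16 (L : Type*) [Field L] [NumberField L] :
    (classNumber L : ℝ) * Units.regulator L ≤
      Real.sqrt (|NumberField.discr L| : ℝ) *
        (max 1 (Real.log (|NumberField.discr L| : ℝ))) ^ (Module.finrank ℚ L - 1) := by
  obtain ⟨h1, h2⟩ := lou_limit L
  refine h2.trans ?_
  have hΔ : (0 : ℝ) < |(NumberField.discr L : ℝ)| := by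
    rw [abs_pos]
    exact_mod_cast NumberField.discr_ne_zero L
  set Δ := |(NumberField.discr L : ℝ)| with hΔdef
  set M := max 1 (Real.log Δ) with hM
  set s := InfinitePlace.nrComplexPlaces L with hs
  set r := Units.rank L with hr
  have hn : Module.finrank ℚ L - 1 = r + s := by
    have e1 := InfinitePlace.card_add_two_mul_card_eq_rank L
    have e2 := InfinitePlace.card_eq_nrRealPlaces_add_nrComplexPlaces L
    have e3 : 0 < Fintype.card (InfinitePlace L) := Fintype.card_pos
    rw [hr, Units.rank]
    omega
  set l := Real.log (louD L) with hl
  have hl0 : 0 ≤ l := Real.log_nonneg h1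
  have hpi : 2 / Real.pi ≤ 1 := by
    rw [div_le_one Real.pi_pos]
    exact Real.two_le_pi
  have hdle : louD L ≤ Real.sqrt Δ := by
    unfold louD
    exact mul_le_of_le_one_left (Real.sqrt_nonneg _) (pow_le_one₀ (by positivity) hpi)
  have h2l : 2 * l ≤ M := by
    have : l ≤ Real.log (Real.sqrt Δ) := Real.log_le_log (by linarith) hdle
    rw [Real.log_sqrt hΔ.le] at this
    have := le_max_right 1 (Real.log Δ)
    linarith
  have hM1 : 1 ≤ M := le_max_left _ _
  have hb : 2 / Real.pi * (1 + l) ≤ M := by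
    have h3 : 2 / Real.pi ≤ 2 / 3 := by
      apply div_le_div_of_nonneg_left (by norm_num) (by norm_num) Real.pi_gt_three.le
    calc 2 / Real.pi * (1 + l) ≤ 2 / 3 * (1 + l) := by gcongr
      _ ≤ M := by linarith
  have hmin : 0 ≤ min 1 l := le_min zero_le_one hl0
  rw [hn]
  calc louD L * (1 + l) ^ (r + s) * min 1 l ^ r
      = Real.sqrt Δ * (((1 + l) * min 1 l) ^ r * (2 / Real.pi * (1 + l)) ^ s) := by
        rw [show louD L = (2 / Real.pi) ^ s * Real.sqrt Δ from rfl, mul_pow, mul_pow, pow_add]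
        ring
    _ ≤ Real.sqrt Δ * (M ^ r * M ^ s) := by
        have := (lou_min_bound hl0).trans h2l
        gcongr
    _ = _ := by rw [pow_add]
end

section
/- Let $A$ be a commutative integral domain that is finitely generated as a $\mathbb{Z}$-algebra. Then the unit group $A^*$ of $A$ is a finitely generated abelian group. -/
open IsDedekindDomain WithZero

/-- Subgroups (up to embedding) of finitely generated commutative groups are finitely generated. -/
theorem roq_fg_of_injective {G H : Type*} [CommGroup G] [CommGroup H] [Group.FG H]
    (f : G →* H) (hf : Function.Injective f) : Group.FG G := by
  have h1 : Module.Finite ℤ (Additive H) := by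
    rw [Module.Finite.iff_addGroup_fg]; infer_instance
  have h2 : Module.Finite ℤ (Additive G) :=
    Module.Finite.of_injective (MonoidHom.toAdditive f).toIntLinearMap hf
  rw [Module.Finite.iff_addGroup_fg] at h2
  exact GroupFG.iff_add_fg.mpr h2

/-- Extensions. -/
theorem roq_fg_of_ker {G H : Type*} [CommGroup G] [CommGroup H] [Group.FG H]
    (f : G →* H) (hf : Group.FG f.ker) : Group.FG G := by
  have hr : Group.FG f.range := roq_fg_of_injective f.range.subtype f.range.subtype_injective
  have hr' : Group.FG (G ⧸ f.ker) :=
    roq_fg_of_injective (QuotientGroup.quotientKerEquivRange f).toMonoidHom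
      (QuotientGroup.quotientKerEquivRange f).injective
  obtain ⟨S, hS, hSf⟩ := Group.fg_iff.mp hr'
  obtain ⟨T, hT, hTf⟩ := Group.fg_iff.mp hf
  refine Group.fg_iff.mpr ⟨Quotient.out '' S ∪ Subtype.val '' T, ?_, (hSf.image _).union (hTf.image _)⟩
  set N := Subgroup.closure (Quotient.out '' S ∪ (Subtype.val : f.ker → G) '' T) with hN
  have hk : f.ker ≤ N := by
    have : (Subgroup.closure T).map f.ker.subtype ≤ N := by
      rw [MonoidHom.map_closure]
      exact Subgroup.closure_mono Set.subset_union_right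
    rw [hT] at this
    intro x hx
    exact this ⟨⟨x, hx⟩, trivial, rfl⟩
  have hm : N.map (QuotientGroup.mk' f.ker) = ⊤ := by
    rw [eq_top_iff, ← hS, Subgroup.closure_le]
    intro s hs
    exact ⟨Quotient.out s, Subgroup.subset_closure (Or.inl ⟨s, hs, rfl⟩), QuotientGroup.out_eq' s⟩
  rw [eq_top_iff]
  intro x _
  obtain ⟨y, hy, hxy⟩ : (QuotientGroup.mk' f.ker x) ∈ N.map (QuotientGroup.mk' f.ker) := by
    rw [hm]; trivial
  have : y⁻¹ * x ∈ f.ker := QuotientGroup.eq.mp hxy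
  have := N.mul_mem hy (hk this)
  simpa using this

/-- The degree valuation. -/
noncomputable def roqVal (F σ : Type*) [Field F] : Valuation (MvPolynomial σ F) ℤᵐ⁰ where
  toFun p := by classical exact if p = 0 then 0 else exp (p.totalDegree : ℤ)
  map_zero' := by simp
  map_one' := by simp
  map_mul' p q := by
    by_cases hp : p = 0
    · simp [hp]
    by_cases hq : q = 0
    · simp [hq]
    simp [hp, hq, MvPolynomial.totalDegree_mul_of_isDomain hp hq, exp_add]
  map_add_le_max' p q := by
    by_cases hp : p = 0
    · have h : p + q = q := by rw [hp, zero_add]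
      refine le_max_of_le_right (le_of_eq ?_)
      by_cases hq : q = 0 <;> simp [hq, hp]
    by_cases hq : q = 0
    · have h : p + q = p := by rw [hq, add_zero]
      refine le_max_of_le_left (le_of_eq ?_)
      simp [h, hp]
    by_cases hpq : p + q = 0
    · simp [hpq]
    simp only [hp, hq, hpq, if_false, le_max_iff, exp_le_exp, Nat.cast_le]
    simpa using MvPolynomial.totalDegree_add p q

theorem roqVal_apply {F σ : Type*} [Field F] {p : MvPolynomial σ F} (hp : p ≠ 0) :
    roqVal F σ p = exp (p.totalDegree : ℤ) := by
  simp [roqVal, hp]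

theorem roq_pid {K : Type*} [Field K] (v : Valuation K ℤᵐ⁰) :
    IsPrincipalIdealRing v.valuationSubring := by
  refine ⟨fun I => ?_⟩
  have hv := Valuation.valuationSubring.integers v
  by_cases hI : I = ⊥
  · subst hI; infer_instance
  rw [hv.isPrincipal_iff_exists_isGreatest]
  obtain ⟨x, hx, hx0⟩ := Submodule.exists_mem_ne_zero_of_ne_bot hI
  let P : ℕ → Prop := fun n => ∃ y ∈ I, v (algebraMap v.valuationSubring K y) = exp (-(n : ℤ))
  have key : ∀ y : v.valuationSubring, y ≠ 0 → ∃ n : ℕ,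
      v (algebraMap v.valuationSubring K y) = exp (-(n : ℤ)) := by
    intro y hy
    have h1 : v (algebraMap v.valuationSubring K y) ≤ 1 := y.2
    have h0 : v (algebraMap v.valuationSubring K y) ≠ 0 := by
      rw [Valuation.ne_zero_iff]
      simpa using hy
    obtain ⟨m, hm⟩ : ∃ m : ℤ, v (algebraMap v.valuationSubring K y) = exp m :=
      ⟨log (v (algebraMap v.valuationSubring K y)), (exp_log h0).symm⟩
    rw [hm, ← exp_zero, exp_le_exp] at h1
    exact ⟨(-m).toNat, by rw [hm]; congr; lia⟩
  have hP : ∃ n, P n := by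
    obtain ⟨n, hn⟩ := key x hx0
    exact ⟨n, x, hx, hn⟩
  classical
  obtain ⟨y, hy, hyn⟩ := Nat.find_spec hP
  refine ⟨_, ⟨y, hy, rfl⟩, ?_⟩
  rintro _ ⟨z, hz, rfl⟩
  by_cases hz0 : z = 0
  · simp [hz0]
  obtain ⟨n, hn⟩ := key z hz0
  have := Nat.find_min' hP ⟨z, hz, hn⟩
  simp only [Function.comp]
  rw [hn, hyn, exp_le_exp]
  lia

theorem roq_core (D E L : Type*) [CommRing D] [IsDomain D] [IsPrincipalIdealRing D] [IsLocalRing D]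
    [Field E] [Algebra D E] [IsFractionRing D E] [Field L] [Algebra E L] [Algebra D L]
    [IsScalarTower D E L] [FiniteDimensional E L] [Algebra.IsSeparable E L] :
    ∃ (H : Type) (_ : CommGroup H) (_ : Group.FG H) (V : Lˣ →* H),
      ∀ w : Lˣ, V w = 1 → IsIntegral D (w : L) := by
  have : IsDedekindDomain (integralClosure D L) := integralClosure.isDedekindDomain D E L
  have : IsFractionRing (integralClosure D L) L :=
    integralClosure.isFractionRing_of_finite_extension E L
  have hfin : Finite (HeightOneSpectrum (integralClosure D L)) := by
    obtain ⟨b, hb⟩ := (IsPrincipalIdealRing.principal (IsLocalRing.maximalIdeal D)).principal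
    have key : ∀ v : HeightOneSpectrum (integralClosure D L),
        (v.asIdeal.comap (algebraMap D (integralClosure D L))) = IsLocalRing.maximalIdeal D ∧
        (v.asIdeal.comap (algebraMap D (integralClosure D L))) ≠ ⊥ := by
      intro v
      have h0 : (v.asIdeal.comap (algebraMap D (integralClosure D L))) ≠ ⊥ :=
        fun h => v.ne_bot (Ideal.eq_bot_of_comap_eq_bot h)
      have : (v.asIdeal.comap (algebraMap D (integralClosure D L))).IsPrime := inferInstance
      exact ⟨IsLocalRing.eq_maximalIdeal (this.isMaximal h0), h0⟩
    refine Set.finite_univ_iff.mp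
      ((HeightOneSpectrum.Support.finite (integralClosure D L) (algebraMap D L b)⁻¹).subset ?_)
    intro v _
    obtain ⟨h1, h0⟩ := key v
    have hb0 : b ≠ 0 := by
      rintro rfl
      rw [h1, hb] at h0
      simp at h0
    have hbv : algebraMap D (integralClosure D L) b ∈ v.asIdeal := by
      rw [← Ideal.mem_comap, h1, hb]
      exact Submodule.mem_span_singleton_self b
    have h3 := (v.valuation_lt_one_iff_mem (K := L) (algebraMap D (integralClosure D L) b)).mpr hbv
    change v.valuation L (algebraMap D L b) < 1 at h3
    have h4 : algebraMap D L b ≠ 0 := by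
      rw [IsScalarTower.algebraMap_apply D E L]
      simpa using hb0
    change 1 < v.valuation L _
    rw [map_inv₀]
    exact (one_lt_inv₀ (zero_lt_iff.mpr ((Valuation.ne_zero_iff _).mpr h4))).mpr h3
  obtain ⟨n, ⟨e⟩⟩ := Finite.exists_equiv_fin (HeightOneSpectrum (integralClosure D L))
  refine ⟨Fin n → Multiplicative ℤ, inferInstance, inferInstance,
    MonoidHom.pi fun i => (e.symm i).valuationOfNeZero, fun w hw => ?_⟩
  obtain ⟨y, hy⟩ := HeightOneSpectrum.mem_integers_of_valuation_le_one L (R := integralClosure D L) (w : L) (by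
    intro v
    have : (e.symm (e v)).valuationOfNeZero w = 1 := congrFun hw (e v)
    rw [Equiv.symm_apply_apply] at this
    rw [← HeightOneSpectrum.valuationOfNeZero_eq, this]
    rfl)
  rw [← hy]
  exact y.2

set_option maxHeartbeats 1000000 in
theorem roq_rosenlicht (F C : Type*) [Field F] [IsAlgClosed F] [CommRing C] [IsDomain C]
    [Algebra F C] [Algebra.FiniteType F C] :
    ∃ (H : Type) (_ : CommGroup H) (_ : Group.FG H) (V : Cˣ →* H),
      ∀ u : Cˣ, V u = 1 → ∃ c : F, algebraMap F C c = u := by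
  obtain ⟨s, g, hg, hfin⟩ := exists_finite_inj_algHom_of_fg F C
  let R := MvPolynomial (Fin s) F
  let : Algebra R C := g.toRingHom.toAlgebra
  have hRC : Function.Injective (algebraMap R C) := hg
  have : IsScalarTower F R C := IsScalarTower.of_algebraMap_eq fun x => (g.commutes x).symm
  have : Module.Finite R C := hfin
  have : FaithfulSMul R C := (faithfulSMul_iff_algebraMap_injective R C).mpr hRC
  let E := FractionRing R
  let K := FractionRing C
  let : Algebra E K := FractionRing.liftAlgebra R K
  have : IsScalarTower R E K := FractionRing.isScalarTower_liftAlgebra R K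
  have : FiniteDimensional E K := .of_isLocalization R C (nonZeroDivisors R)
  let Ks := separableClosure E K
  have : IsPurelyInseparable Ks K := separableClosure.isPurelyInseparable E K
  let q := ringExpChar Ks
  have : FiniteDimensional Ks K := inferInstance
  let Φ : K →+* Ks := IsPurelyInseparable.iterateFrobenius Ks K q le_rfl
  have hΦ : ∀ a : K, (Φ a : K) = a ^ q ^ (IsPurelyInseparable.exponent Ks K) := fun a =>
    IsPurelyInseparable.algebraMap_iterateFrobenius Ks q le_rfl a
  have hq : 0 < q ^ (IsPurelyInseparable.exponent Ks K) := expChar_pow_pos Ks q _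
  have hS : nonZeroDivisors R ≤ (roqVal F (Fin s)).supp.primeCompl := by
    intro p hp hp'
    have hp0 : p ≠ 0 := nonZeroDivisors.ne_zero hp
    have : roqVal F (Fin s) p = 0 := hp'
    rw [roqVal_apply hp0] at this
    exact exp_ne_zero this
  let v : Valuation E ℤᵐ⁰ := (roqVal F (Fin s)).extendToLocalization hS E
  have hv : ∀ p : R, v (algebraMap R E p) = roqVal F (Fin s) p := fun p =>
    Valuation.extendToLocalization_apply_map_apply _ hS E p
  let D := v.valuationSubring
  have : IsPrincipalIdealRing D := roq_pid v
  let : Algebra D Ks := ((algebraMap E Ks).comp (algebraMap D E)).toAlgebra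
  have : IsScalarTower D E Ks := IsScalarTower.of_algebraMap_eq fun _ => rfl
  have : IsScalarTower R Ks K := IsScalarTower.of_algebraMap_eq fun _ => rfl
  have : IsScalarTower F Ks K := IsScalarTower.of_algebraMap_eq fun _ => rfl
  obtain ⟨H, i1, i2, V, hV⟩ := roq_core D E Ks
  refine ⟨H, i1, i2, V.comp (Units.map ((Φ.comp (algebraMap C K)) : C →* Ks)), fun u hu => ?_⟩
  have hD := hV _ hu
  set w : Ks := Φ (algebraMap C K u) with hw
  have hD : IsIntegral D w := hD
  have hwK : (w : K) = algebraMap C K ((u : C) ^ q ^ (IsPurelyInseparable.exponent Ks K)) := by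
    rw [hw, hΦ, map_pow]
  have hR : IsIntegral R w := by
    have h1 : IsIntegral R (w : K) := by
      rw [hwK]
      exact (Algebra.IsIntegral.isIntegral (R := R) _).map (IsScalarTower.toAlgHom R C K)
    exact (isIntegral_algHom_iff (IsScalarTower.toAlgHom R Ks K) (algebraMap Ks K).injective).mp h1
  have e1 := minpoly.isIntegrallyClosed_eq_field_fractions' E hD
  have e2 := minpoly.isIntegrallyClosed_eq_field_fractions' E hR
  have hc : ∀ n, ∃ c : F, (minpoly E w).coeff n = algebraMap F E c := by
    intro n
    have h1 : v ((minpoly E w).coeff n) ≤ 1 := by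
      rw [e1, Polynomial.coeff_map]
      exact ((minpoly D w).coeff n).2
    rw [e2, Polynomial.coeff_map] at h1 ⊢
    rw [hv] at h1
    set p := (minpoly R w).coeff n
    by_cases hp : p = 0
    · exact ⟨0, by rw [hp]; simp⟩
    rw [roqVal_apply hp, ← exp_zero, exp_le_exp] at h1
    have h2 : p.totalDegree = 0 := by lia
    rw [MvPolynomial.totalDegree_eq_zero_iff_eq_C] at h2
    refine ⟨p.coeff 0, ?_⟩
    rw [IsScalarTower.algebraMap_apply F R E]
    exact congrArg _ h2
  have hlift : minpoly E w ∈ Polynomial.lifts (algebraMap F E) := by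
    rw [Polynomial.lifts_iff_coeff_lifts]
    intro n
    obtain ⟨c, hc⟩ := hc n
    exact ⟨c, hc.symm⟩
  obtain ⟨f, hf, -, hfm⟩ := Polynomial.lifts_and_degree_eq_and_monic hlift
    (minpoly.monic (Algebra.IsIntegral.isIntegral w))
  have hwF : IsIntegral F w := by
    refine ⟨f, hfm, ?_⟩
    have := minpoly.aeval E w
    rw [← hf, Polynomial.aeval_map_algebraMap] at this
    exact this
  have hwF' : IsIntegral F (w : K) := hwF.map (IsScalarTower.toAlgHom F Ks K)
  rw [hwK] at hwF'
  have huF : IsIntegral F (u : C) := by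
    have : IsIntegral F ((u : C) ^ q ^ (IsPurelyInseparable.exponent Ks K)) :=
      (isIntegral_algHom_iff (IsScalarTower.toAlgHom F C K) (IsFractionRing.injective C K)).mp hwF'
    exact this.of_pow hq
  obtain ⟨c, hc⟩ := (IsAlgClosed.algebraMap_bijective_of_isIntegral
    (k := F) (K := integralClosure F C)).2 ⟨u, huF⟩
  exact ⟨c, congrArg Subtype.val hc⟩

theorem roq_numberField (K B : Type*) [Field K] [NumberField K] [CommRing B]
    [Algebra.FiniteType ℤ B] (f : B →+* K) (hf : Function.Injective f) : Group.FG Bˣ := by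
  obtain ⟨S, hS⟩ := Algebra.FiniteType.out (R := ℤ) (A := B)
  let T : Set (HeightOneSpectrum (NumberField.RingOfIntegers K)) :=
    ⋃ x ∈ S, HeightOneSpectrum.Support (NumberField.RingOfIntegers K) (f x)
  have hT : T.Finite := S.finite_toSet.biUnion fun x _ => HeightOneSpectrum.Support.finite _ _
  have hT' : Finite T := hT
  have hle : ∀ v, v ∉ T → ∀ b : B, v.valuation K (f b) ≤ 1 := by
    intro v hv b
    have hb : b ∈ Algebra.adjoin ℤ (S : Set B) := by rw [hS]; trivial
    induction hb using Algebra.adjoin_induction with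
    | mem x hx =>
      by_contra h
      exact hv (Set.mem_biUnion hx (not_le.mp h))
    | algebraMap r =>
      have : f (algebraMap ℤ B r) =
          algebraMap (NumberField.RingOfIntegers K) K (r : NumberField.RingOfIntegers K) := by simp
      rw [this]
      exact v.valuation_le_one _
    | add x y _ _ hx hy =>
      rw [map_add]
      exact (Valuation.map_add _ _ _).trans (max_le hx hy)
    | mul x y _ _ hx hy =>
      rw [map_mul, map_mul]
      exact mul_le_one' hx hy
  let V : Bˣ →* (T → Multiplicative ℤ) :=
    (MonoidHom.pi fun v : T => v.1.valuationOfNeZero (K := K)).comp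
      (Units.map (f : B →* K))
  have hV : ∀ u, V u = 1 → f u ∈ (algebraMap (NumberField.RingOfIntegers K) K).range := by
    intro u hu
    refine HeightOneSpectrum.mem_integers_of_valuation_le_one K _ fun v => ?_
    by_cases hv : v ∈ T
    · have : v.valuationOfNeZero (K := K) (Units.map (f : B →* K) u) = 1 := congrFun hu ⟨v, hv⟩
      have h2 := HeightOneSpectrum.valuationOfNeZero_eq v (Units.map (f : B →* K) u)
      rw [this] at h2
      exact h2.ge
    · exact hle v hv u
  have : Group.FG (NumberField.RingOfIntegers K)ˣ := Group.fg_iff_monoid_fg.mpr inferInstance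
  let j : (NumberField.RingOfIntegers K)ˣ →* Kˣ :=
    Units.map (algebraMap (NumberField.RingOfIntegers K) K : _ →* K)
  refine roq_fg_of_ker V ?_
  let h : V.ker →* j.range := ((Units.map (f : B →* K)).comp V.ker.subtype).codRestrict j.range (by
    rintro ⟨u, hu⟩
    obtain ⟨a, ha⟩ := hV u hu
    obtain ⟨b, hb⟩ := hV u⁻¹ (by rw [map_inv, MonoidHom.mem_ker.mp hu, inv_one])
    have hab : a * b = 1 := by
      apply NumberField.RingOfIntegers.coe_injective
      rw [map_mul, ha, hb, ← map_mul, map_one]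
      simp
    exact ⟨⟨a, b, hab, by rw [mul_comm, hab]⟩, Units.ext ha⟩)
  refine roq_fg_of_injective h ?_
  rintro ⟨x, hx⟩ ⟨y, hy⟩ hxy
  have h1 : Units.map (f : B →* K) x = Units.map (f : B →* K) y := congrArg Subtype.val hxy
  exact Subtype.ext (Units.ext (hf (congrArg Units.val h1)))

theorem roq_base_zero (F B : Type*) [Field F] [Algebra ℚ F] [Algebra.IsAlgebraic ℚ F] [CommRing B]
    [Algebra.FiniteType ℤ B] (f : B →+* F) (hf : Function.Injective f) : Group.FG Bˣ := by
  obtain ⟨S, hS⟩ := Algebra.FiniteType.out (R := ℤ) (A := B)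
  let K := IntermediateField.adjoin ℚ (f '' S)
  have hfin : Finite (f '' (S : Set B)) := S.finite_toSet.image f
  have hfd : FiniteDimensional ℚ K :=
    IntermediateField.finiteDimensional_adjoin fun x _ => Algebra.IsIntegral.isIntegral x
  have hcz : CharZero K := algebraRat.charZero K
  have : NumberField K := by
    refine @NumberField.mk K _ hcz ?_
    convert hfd
    exact Subsingleton.elim _ _
  have hK : ∀ b, f b ∈ K := by
    intro b
    have hb : b ∈ Algebra.adjoin ℤ (S : Set B) := by rw [hS]; trivial
    induction hb using Algebra.adjoin_induction with
    | mem x hx => exact IntermediateField.subset_adjoin _ _ ⟨x, hx, rfl⟩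
    | algebraMap r => simp
    | add x y _ _ hx hy => rw [map_add]; exact add_mem hx hy
    | mul x y _ _ hx hy => rw [map_mul]; exact mul_mem hx hy
  refine roq_numberField K B (f.codRestrict K hK) fun x y hxy => hf ?_
  exact congrArg Subtype.val hxy

theorem roq_base_p (p : ℕ) [Fact p.Prime] (F B : Type*) [Field F] [Algebra (ZMod p) F]
    [Algebra.IsAlgebraic (ZMod p) F] [CommRing B]
    [Algebra.FiniteType ℤ B] (f : B →+* F) (hf : Function.Injective f) : Group.FG Bˣ := by
  have hint : Algebra.IsIntegral ℤ B := by
    refine ⟨fun b => ?_⟩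
    have h1 : IsIntegral (ZMod p) (f b) := Algebra.IsIntegral.isIntegral _
    have h0 : Module.Finite ℤ (ZMod p) := 
      Module.Finite.of_surjective (Algebra.linearMap ℤ (ZMod p)) ZMod.intCast_surjective
    have h2 : IsIntegral ℤ (f b) := isIntegral_trans (A := ZMod p) (f b) h1
    exact (isIntegral_algHom_iff f.toIntAlgHom hf).mp h2
  have hfin : Module.Finite ℤ B := Algebra.IsIntegral.finite
  have : CharP F p := charP_of_injective_algebraMap (algebraMap (ZMod p) F).injective p
  have hB : AddGroup.FG B := by rwa [← Module.Finite.iff_addGroup_fg]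
  have : Finite B := by
    refine AddCommGroup.finite_of_fg_isAddTorsion B ?_
    intro b
    rw [isOfFinAddOrder_iff_nsmul_eq_zero]
    refine ⟨p, (Fact.out : p.Prime).pos, hf ?_⟩
    rw [map_nsmul, map_zero, nsmul_eq_mul, CharP.cast_eq_zero, zero_mul]
  infer_instance

theorem roq_point (F C : Type*) [Field F] [IsAlgClosed F] [CommRing C] [Nontrivial C]
    [Algebra F C] [Algebra.FiniteType F C] : Nonempty (C →ₐ[F] F) := by
  obtain ⟨m, hm⟩ := Ideal.exists_maximal C
  let : Field (C ⧸ m) := Ideal.Quotient.field m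
  have : Module.Finite F (C ⧸ m) := finite_of_finite_type_of_isJacobsonRing F (C ⧸ m)
  have hb : Function.Bijective (algebraMap F (C ⧸ m)) :=
    IsAlgClosed.algebraMap_bijective_of_isIntegral
  exact ⟨((AlgEquiv.ofBijective (Algebra.ofId F (C ⧸ m)) hb).symm : (C ⧸ m) →ₐ[F] F).comp
    (Ideal.Quotient.mkₐ F m)⟩

set_option maxHeartbeats 1000000 in
theorem roq_main (k L A : Type*) [Field k] [Field L] [Algebra k L] [IsAlgClosed L]
    [CommRing A] [Algebra.FiniteType ℤ A] (f : A →+* L) (hf : Function.Injective f)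
    (hbase : ∀ B : Subring (algebraicClosure k L), Algebra.FiniteType ℤ B → Group.FG Bˣ) :
    Group.FG Aˣ := by
  let F := algebraicClosure k L
  have : IsAlgClosed F := IsAlgClosure.isAlgClosed k
  obtain ⟨S, hS⟩ := Algebra.FiniteType.out (R := ℤ) (A := A)
  let C : Subalgebra F L := Algebra.adjoin F (f '' S)
  have hC : Algebra.FiniteType F C := by
    refine (Subalgebra.fg_iff_finiteType C).mp (Subalgebra.fg_def.mpr ⟨f '' S, ?_, rfl⟩)
    exact S.finite_toSet.image f
  have hfC : ∀ b, f b ∈ C := by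
    intro b
    have hb : b ∈ Algebra.adjoin ℤ (S : Set A) := by rw [hS]; trivial
    induction hb using Algebra.adjoin_induction with
    | mem x hx => exact Algebra.subset_adjoin ⟨x, hx, rfl⟩
    | algebraMap r => simp
    | add x y _ _ hx hy => rw [map_add]; exact add_mem hx hy
    | mul x y _ _ hx hy => rw [map_mul]; exact mul_mem hx hy
  let fC : A →+* C := f.codRestrict C hfC
  have hfCi : Function.Injective fC := fun x y hxy => hf (congrArg Subtype.val hxy)
  -- a point of `C`
  obtain ⟨φ⟩ := roq_point F C
  let ψ : A →+* F := (φ : C →+* F).comp fC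
  have hB : Algebra.FiniteType ℤ ψ.range :=
    Algebra.FiniteType.of_surjective (ψ.rangeRestrict.toIntAlgHom) ψ.rangeRestrict_surjective
  have hBfg := hbase ψ.range hB
  obtain ⟨H, i1, i2, V, hV⟩ := roq_rosenlicht F C
  refine roq_fg_of_injective ((Units.map (ψ.rangeRestrict : A →* ψ.range)).prod
    (V.comp (Units.map (fC : A →* C)))) ?_
  rw [injective_iff_map_eq_one]
  intro u hu
  have h1 : Units.map (ψ.rangeRestrict : A →* ψ.range) u = 1 := congrArg Prod.fst hu
  have h2 : V (Units.map (fC : A →* C) u) = 1 := congrArg Prod.snd hu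
  obtain ⟨c, hc⟩ := hV _ h2
  have hc : algebraMap F C c = fC u := hc
  have h3 : φ (fC u) = 1 := congrArg Subtype.val (congrArg Units.val h1)
  rw [← hc, AlgHom.commutes] at h3
  have h3 : c = 1 := h3
  rw [h3, map_one] at hc
  exact Units.ext (hfCi (by rw [← hc, Units.val_one, map_one]))

/-- Roquette: The unit group of a commutative integral domain that is
finitely generated as a `ℤ`-algebra is a finitely generated (abelian) group. -/
theorem stmt_17 (A : Type*) [CommRing A] [IsDomain A] [Algebra.FiniteType ℤ A] :
    Group.FG Aˣ := by
  let L := AlgebraicClosure (FractionRing A)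
  let f : A →+* L := (algebraMap (FractionRing A) L).comp (algebraMap A (FractionRing A))
  have hf : Function.Injective f :=
    (algebraMap (FractionRing A) L).injective.comp (IsFractionRing.injective A (FractionRing A))
  obtain ⟨p, hp⟩ := CharP.exists L
  rcases CharP.char_is_prime_or_zero L p with hpp | rfl
  · have : Fact p.Prime := ⟨hpp⟩
    let : Algebra (ZMod p) L := ZMod.algebra L p
    exact roq_main (ZMod p) L A f hf fun B hB =>
      roq_base_p p (algebraicClosure (ZMod p) L) B B.subtype B.subtype_injective
  · have : CharZero L := CharP.charP_to_charZero L
    let : Algebra ℚ L := DivisionRing.toRatAlgebra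
    exact roq_main ℚ L A f hf fun B hB =>
      have : Algebra.IsAlgebraic ℚ (algebraicClosure ℚ L) :=
        algebraicClosure.isAlgebraic ℚ L
      @roq_base_zero (algebraicClosure ℚ L) B _ (algebraicClosure ℚ L).algebra' this _ hB B.subtype B.subtype_injective
end
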